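/- For every integer n ≥ 2 and every real x₀, |Σ_{λ partition of n with (√2/n)·(n(λ')−n(λ)) ≤ x₀} π_1(λ) − Φ(x₀)| ≤ 40.1 · n^{−1/4}. -/

import Mathlib

open Finset

namespace JackTest

def colLen {n : ℕ} (lam : n.Partition) (j : ℕ) : ℕ :=
  (lam.parts.filter (fun p => j < p)).card

def rowLen {n : ℕ} (lam : n.Partition) (i : ℕ) : ℕ :=
  ((Finset.range n).filter (fun j => i < colLen lam j)).card

def cells {n : ℕ} (lam : n.Partition) : Finset (ℕ × ℕ) :=
  (Finset.range n ×ˢ Finset.range n).filter (fun s => s.2 < rowLen lam s.1)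

def arm {n : ℕ} (lam : n.Partition) (s : ℕ × ℕ) : ℕ := rowLen lam s.1 - (s.2 + 1)

def leg {n : ℕ} (lam : n.Partition) (s : ℕ × ℕ) : ℕ := colLen lam s.2 - (s.1 + 1)

noncomputable def cLow (α : ℝ) {n : ℕ} (lam : n.Partition) : ℝ :=
  ∏ s ∈ cells lam, (α * arm lam s + leg lam s + 1)

noncomputable def cUp (α : ℝ) {n : ℕ} (lam : n.Partition) : ℝ :=
  ∏ s ∈ cells lam, (α * arm lam s + leg lam s + α)

noncomputable def jackP (α : ℝ) {n : ℕ} (lam : n.Partition) : ℝ :=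
  α ^ n * (n.factorial) / (cLow α lam * cUp α lam)

def nStat {n : ℕ} (lam : n.Partition) : ℕ := ∑ i ∈ Finset.range n, i * rowLen lam i

def nStatConj {n : ℕ} (lam : n.Partition) : ℕ := ∑ j ∈ Finset.range n, j * colLen lam j

noncomputable def W (α : ℝ) {n : ℕ} (lam : n.Partition) : ℝ :=
  (α * nStatConj lam - nStat lam) / Real.sqrt (α * n.choose 2)

noncomputable def Phi (x : ℝ) : ℝ :=
  (Real.sqrt (2 * Real.pi))⁻¹ * ∫ t in Set.Iic x, Real.exp (-t ^ 2 / 2)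

section Gaussian

open MeasureTheory ProbabilityTheory

/-- The standard normal density. -/
noncomputable def stdDensity (u : ℝ) : ℝ := (Real.sqrt (2 * Real.pi))⁻¹ * Real.exp (-u ^ 2 / 2)

lemma gaussianPDFReal_eq_stdDensity : gaussianPDFReal 0 1 = stdDensity := by
  ext u
  simp [gaussianPDFReal, stdDensity]

lemma integrable_stdDensity : Integrable stdDensity :=
  gaussianPDFReal_eq_stdDensity ▸ integrable_gaussianPDFReal 0 1

lemma Phi_eq_integral (x : ℝ) : Phi x = ∫ t in Set.Iic x, stdDensity t := by
  simp only [Phi, stdDensity]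
  rw [integral_const_mul]

lemma Phi_eq_measureReal (x : ℝ) : Phi x = (gaussianReal 0 1).real (Set.Iic x) := by
  rw [Phi_eq_integral, Measure.real, gaussianReal_apply_eq_integral _ one_ne_zero,
    ENNReal.toReal_ofReal, gaussianPDFReal_eq_stdDensity]
  exact integral_nonneg fun t => gaussianPDFReal_nonneg 0 1 t

lemma Phi_nonneg (x : ℝ) : 0 ≤ Phi x := by
  rw [Phi_eq_measureReal]; exact measureReal_nonneg

lemma Phi_le_one (x : ℝ) : Phi x ≤ 1 := by
  rw [Phi_eq_measureReal]; exact measureReal_le_one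

lemma continuous_stdDensity : Continuous stdDensity := by
  unfold stdDensity; fun_prop

lemma hasDerivAt_Phi (x : ℝ) : HasDerivAt Phi (stdDensity x) x := by
  have h : ∀ y, Phi y = Phi 0 + ∫ t in (0 : ℝ)..y, stdDensity t := by
    intro y
    rw [Phi_eq_integral, Phi_eq_integral, intervalIntegral.integral_Iic_sub_Iic
      integrable_stdDensity.integrableOn integrable_stdDensity.integrableOn |>.symm]
    ring
  have h2 := intervalIntegral.integral_hasDerivAt_right
    (continuous_stdDensity.intervalIntegrable 0 x)
    (continuous_stdDensity.stronglyMeasurableAtFilter _ _)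
    continuous_stdDensity.continuousAt
  have h3 := h2.const_add (Phi 0)
  exact h3.congr_of_eventuallyEq (Filter.Eventually.of_forall h)

lemma hasDerivAt_stdDensity (x : ℝ) : HasDerivAt stdDensity (-x * stdDensity x) x := by
  have h1 : HasDerivAt (fun u : ℝ => -u ^ 2 / 2) (-x) x := by
    have := ((hasDerivAt_pow 2 x).neg).div_const 2
    refine this.congr_deriv ?_
    simp
    ring
  have h2 := (h1.exp).const_mul (Real.sqrt (2 * Real.pi))⁻¹
  refine h2.congr_deriv ?_
  simp only [stdDensity]
  ring

lemma stdDensity_nonneg (x : ℝ) : 0 ≤ stdDensity x := by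
  unfold stdDensity; positivity

lemma stdDensity_mul_le {x c : ℝ} (hc : c ≤ 1 + x ^ 2 / 2 + (x ^ 2 / 2) ^ 2 / 2) :
    c * stdDensity x ≤ 1 := by
  have h1 : c ≤ Real.exp (x ^ 2 / 2) :=
    hc.trans (Real.quadratic_le_exp_of_nonneg (by positivity))
  have h2 : (Real.sqrt (2 * Real.pi))⁻¹ ≤ 1 := by
    apply inv_le_one_of_one_le₀
    rw [Real.one_le_sqrt]
    linarith [Real.pi_gt_three]
  have h3 : stdDensity x ≤ Real.exp (-x ^ 2 / 2) := by
    unfold stdDensity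
    exact mul_le_of_le_one_left (Real.exp_nonneg _) h2
  calc c * stdDensity x ≤ Real.exp (x ^ 2 / 2) * stdDensity x := by
        gcongr; exact stdDensity_nonneg x
    _ ≤ Real.exp (x ^ 2 / 2) * Real.exp (-x ^ 2 / 2) := by gcongr
    _ = 1 := by rw [← Real.exp_add]; simp [neg_div]

lemma abs_mul_stdDensity_le {x c d : ℝ} (hd : 0 < d)
    (hc : |c| ≤ d * (1 + x ^ 2 / 2 + (x ^ 2 / 2) ^ 2 / 2)) :
    |c * stdDensity x| ≤ d := by
  rw [abs_mul, abs_of_nonneg (stdDensity_nonneg x)]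
  have := stdDensity_mul_le (x := x) (c := |c| / d) (by rw [div_le_iff₀ hd]; linarith)
  rw [div_mul_eq_mul_div, div_le_one hd] at this
  exact this

/-- If `g` vanishes at `0` and `g'` is bounded between `0` and `h`, then so is `g h`. -/
lemma abs_le_of_abs_deriv_le {g g' : ℝ → ℝ} {h C : ℝ} (g0 : g 0 = 0)
    (hg : ∀ t ∈ Set.uIcc 0 h, HasDerivAt g (g' t) t)
    (hC : ∀ t ∈ Set.uIcc 0 h, |g' t| ≤ C) : |g h| ≤ C * |h| := by
  have := (convex_uIcc 0 h).norm_image_sub_le_of_norm_hasDerivWithin_le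
    (fun t ht => (hg t ht).hasDerivWithinAt) hC Set.left_mem_uIcc Set.right_mem_uIcc
  simpa [g0] using this

lemma abs_le_of_mem_uIcc {h t : ℝ} (ht : t ∈ Set.uIcc 0 h) : |t| ≤ |h| := by
  have := Set.abs_sub_left_of_mem_uIcc ht
  simpa using this

lemma abs_Phi_sub_le (x y : ℝ) : |Phi x - Phi y| ≤ |x - y| := by
  have := (convex_univ (𝕜 := ℝ) (E := ℝ)).norm_image_sub_le_of_norm_hasDerivWithin_le (C := 1)
    (fun t _ => (hasDerivAt_Phi t).hasDerivWithinAt)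
    (fun t _ => by
      have := abs_mul_stdDensity_le (x := t) (c := 1) one_pos
        (by rw [abs_one]; nlinarith [sq_nonneg t, sq_nonneg (t ^ 2 / 2)])
      simpa using this) (Set.mem_univ y) (Set.mem_univ x)
  simpa using this

/-- Third order Taylor bound for the normal distribution function. -/
lemma Phi_taylor (u h : ℝ) :
    |Phi (u - h) - Phi u + h * stdDensity u + h ^ 2 / 2 * (u * stdDensity u)| ≤ |h| ^ 3 := by
  have hs : ∀ t : ℝ, HasDerivAt (fun t => u - t) (-1) t := fun t => by
    simpa using (hasDerivAt_id t).const_sub u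
  have d0 : ∀ t, HasDerivAt
      (fun t => Phi (u - t) - Phi u + t * stdDensity u + t ^ 2 / 2 * (u * stdDensity u))
      (-stdDensity (u - t) + stdDensity u + t * (u * stdDensity u)) t := by
    intro t
    have h1 := ((hasDerivAt_Phi (u - t)).comp t (hs t))
    have h2 := ((h1.sub_const (Phi u)).add ((hasDerivAt_id t).mul_const (stdDensity u))).add
      (((hasDerivAt_pow 2 t).div_const 2).mul_const (u * stdDensity u))
    refine h2.congr_deriv ?_
    simp
  have d1 : ∀ t, HasDerivAt
      (fun t => -stdDensity (u - t) + stdDensity u + t * (u * stdDensity u))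
      (-((u - t) * stdDensity (u - t)) + u * stdDensity u) t := by
    intro t
    have h1 := ((hasDerivAt_stdDensity (u - t)).comp t (hs t))
    have h2 := ((h1.neg.add_const (stdDensity u))).add
      ((hasDerivAt_id t).mul_const (u * stdDensity u))
    refine h2.congr_deriv ?_
    simp
    ring
  have d2 : ∀ t, HasDerivAt
      (fun t => -((u - t) * stdDensity (u - t)) + u * stdDensity u)
      ((1 - (u - t) ^ 2) * stdDensity (u - t)) t := by
    intro t
    have h1 := ((hasDerivAt_stdDensity (u - t)).comp t (hs t))
    have h2 := (((hs t).mul h1).neg).add_const (u * stdDensity u)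
    refine h2.congr_deriv ?_
    simp
    ring
  have b2 : ∀ t, |-((u - t) * stdDensity (u - t)) + u * stdDensity u| ≤ |t| := by
    intro t
    have := abs_le_of_abs_deriv_le (h := t) (C := 1) (by simp) (fun s _ => d2 s) (fun s _ => by
      apply abs_mul_stdDensity_le one_pos
      rw [abs_le]
      constructor <;> nlinarith [sq_nonneg (u - s), sq_nonneg ((u - s) ^ 2 - 2)])
    simpa using this
  have b1 : ∀ t, |-stdDensity (u - t) + stdDensity u + t * (u * stdDensity u)| ≤ |t| ^ 2 := by
    intro t
    have := abs_le_of_abs_deriv_le (h := t) (C := |t|) (by simp) (fun s _ => d1 s) (fun s hs => by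
      exact (b2 s).trans (abs_le_of_mem_uIcc hs))
    simpa [sq] using this
  have := abs_le_of_abs_deriv_le (h := h) (C := |h| ^ 2) (by simp) (fun s _ => d0 s) (fun s hs => by
      exact (b1 s).trans (by exact pow_le_pow_left₀ (abs_nonneg s) (abs_le_of_mem_uIcc hs) 2))
  simpa [pow_succ] using this

/-- Heat-equation expansion of the normal distribution function in the variance. -/
lemma Phi_heat (u : ℝ) {r : ℝ} (hr : 0 ≤ r) :
    |Phi (u / Real.sqrt (1 + r)) - Phi u + r / 2 * (u * stdDensity u)| ≤ r ^ 2 / 2 := by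
  set w : ℝ → ℝ := fun t => u / Real.sqrt (1 + t) with hw
  have hmem : ∀ {s t : ℝ}, 0 ≤ s → t ∈ Set.uIcc 0 s → 0 ≤ t := by
    intro s t hs ht
    rw [Set.uIcc_of_le hs] at ht
    exact ht.1
  have dw : ∀ t, 0 ≤ t → HasDerivAt w (-(1 / 2) * w t / (1 + t)) t := by
    intro t ht
    have hp : (0 : ℝ) < 1 + t := by linarith
    have h1 : HasDerivAt (fun t : ℝ => 1 + t) 1 t := by simpa using (hasDerivAt_id t).const_add 1
    have h2 := (h1.sqrt hp.ne').inv (Real.sqrt_pos.2 hp).ne'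
    have h3 := h2.const_mul u
    refine h3.congr_deriv ?_
    simp only [hw]
    have hsq := Real.sq_sqrt hp.le
    have hs := Real.sqrt_pos.2 hp
    field_simp
    rw [hsq]
  have d0 : ∀ t, 0 ≤ t → HasDerivAt
      (fun t => Phi (w t) - Phi u + t / 2 * (u * stdDensity u))
      (-(1 / 2) * (w t * stdDensity (w t) / (1 + t)) + 1 / 2 * (u * stdDensity u)) t := by
    intro t ht
    have h1 := (hasDerivAt_Phi (w t)).comp t (dw t ht)
    have h2 := (h1.sub_const (Phi u)).add
      (((hasDerivAt_id t).div_const 2).mul_const (u * stdDensity u))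
    refine h2.congr_deriv ?_
    simp
    ring
  have d1 : ∀ t, 0 ≤ t → HasDerivAt
      (fun t => -(1 / 2) * (w t * stdDensity (w t) / (1 + t)) + 1 / 2 * (u * stdDensity u))
      (1 / 4 * (w t * (3 - w t ^ 2)) / (1 + t) ^ 2 * stdDensity (w t)) t := by
    intro t ht
    have hp : (1 + t) ≠ 0 := by linarith
    have h0 : HasDerivAt (fun t : ℝ => 1 + t) 1 t := by simpa using (hasDerivAt_id t).const_add 1
    have h1 := (hasDerivAt_stdDensity (w t)).comp t (dw t ht)
    have h2 := ((((dw t ht).mul h1).div h0 hp).const_mul (-(1 / 2))).add_const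
      (1 / 2 * (u * stdDensity u))
    refine h2.congr_deriv ?_
    simp
    field_simp
    ring
  have b1 : ∀ t, 0 ≤ t → |-(1 / 2) * (w t * stdDensity (w t) / (1 + t)) +
      1 / 2 * (u * stdDensity u)| ≤ t / 2 := by
    intro t ht
    have := abs_le_of_abs_deriv_le (h := t) (C := 1 / 2) (by simp [hw])
      (fun s hs => d1 s (hmem ht hs)) (fun s hs => by
      have hs0 := hmem ht hs
      apply abs_mul_stdDensity_le (by norm_num)
      rw [abs_div, abs_of_pos (by positivity : (0 : ℝ) < (1 + s) ^ 2)]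
      refine (div_le_self (abs_nonneg _) (by nlinarith)).trans ?_
      have key : |w s * (3 - w s ^ 2)| ≤ 2 * (1 + w s ^ 2 / 2 + (w s ^ 2 / 2) ^ 2 / 2) := by
        rw [abs_le]
        constructor <;>
        nlinarith [sq_nonneg (w s ^ 2 + 2 * w s), sq_nonneg (w s ^ 2 - 2 * w s),
          sq_nonneg (w s - 1), sq_nonneg (w s + 1), sq_nonneg (w s)]
      rw [abs_mul, abs_of_pos (by norm_num : (0 : ℝ) < 1 / 4)]
      linarith)
    rw [abs_of_nonneg ht] at this
    linarith
  have := abs_le_of_abs_deriv_le (h := r) (C := r / 2) (by simp [hw])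
    (fun s hs => d0 s (hmem hr hs)) (fun s hs => by
      have hs0 := hmem hr hs
      rw [Set.uIcc_of_le hr] at hs
      exact (b1 s hs0).trans (by linarith [hs.2]))
  rw [abs_of_nonneg hr] at this
  calc _ ≤ r / 2 * r := this
    _ = r ^ 2 / 2 := by ring

lemma integral_sq_gaussianReal : ∫ z, z ^ 2 ∂(gaussianReal 0 1) = 1 := by
  have h := variance_fun_id_gaussianReal (μ := 0) (v := 1)
  rw [variance_of_integral_eq_zero (by fun_prop) (by simp)] at h
  simpa using h

lemma integrable_sq_gaussianReal : Integrable (fun z : ℝ => z ^ 2) (gaussianReal 0 1) := by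
  have := (memLp_id_gaussianReal (μ := 0) (v := 1) 2)
  exact this.integrable_sq

end Gaussian

section Smoothing

open MeasureTheory ProbabilityTheory

variable {ι : Type*} [Fintype ι]

/-- Distribution function of the finite weighted family `(a, W)`. -/
noncomputable def weightedCdf (a W : ι → ℝ) (x : ℝ) : ℝ := ∑ i, if W i ≤ x then a i else 0

lemma weightedCdf_mono {a W : ι → ℝ} (ha : ∀ i, 0 ≤ a i) : Monotone (weightedCdf a W) := by
  intro x y h
  apply Finset.sum_le_sum
  intro i _
  split_ifs with h1 h2
  · exact le_rfl
  · exact absurd (h1.trans h) h2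
  · exact ha i
  · exact le_rfl

lemma weightedCdf_nonneg {a W : ι → ℝ} (ha : ∀ i, 0 ≤ a i) (x : ℝ) : 0 ≤ weightedCdf a W x :=
  Finset.sum_nonneg fun i _ => by split_ifs; exacts [ha i, le_rfl]

lemma weightedCdf_le_one {a W : ι → ℝ} (ha : ∀ i, 0 ≤ a i) (h1 : ∑ i, a i = 1) (x : ℝ) :
    weightedCdf a W x ≤ 1 :=
  h1 ▸ Finset.sum_le_sum fun i _ => by split_ifs; exacts [le_rfl, ha i]

lemma indicator_comp_eq (a W : ι → ℝ) {δ : ℝ} (hδ : 0 < δ) (y z : ℝ) :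
    weightedCdf a W (y - δ * z) =
      ∑ i, (Set.Iic ((y - W i) / δ)).indicator (fun _ => a i) z := by
  apply Finset.sum_congr rfl
  intro i _
  simp only [Set.indicator, Set.mem_Iic]
  congr 1
  rw [le_div_iff₀ hδ, eq_iff_iff]
  constructor <;> intro h <;> linarith

lemma integrable_weightedCdf (a W : ι → ℝ) {δ : ℝ} (hδ : 0 < δ) (y : ℝ) :
    Integrable (fun z => weightedCdf a W (y - δ * z)) (gaussianReal 0 1) := by
  simp_rw [indicator_comp_eq a W hδ y]
  exact integrable_finsetSum _ fun i _ => (integrable_const _).indicator measurableSet_Iic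

lemma integral_weightedCdf (a W : ι → ℝ) {δ : ℝ} (hδ : 0 < δ) (y : ℝ) :
    ∫ z, weightedCdf a W (y - δ * z) ∂(gaussianReal 0 1) = ∑ i, a i * Phi ((y - W i) / δ) := by
  simp_rw [indicator_comp_eq a W hδ y]
  rw [integral_finsetSum _ fun i _ => (integrable_const _).indicator measurableSet_Iic]
  apply Finset.sum_congr rfl
  intro i _
  rw [integral_indicator_const _ measurableSet_Iic, Phi_eq_measureReal, smul_eq_mul, mul_comm]

/-- Smoothing inequality with a Gaussian kernel of width `δ`. -/
lemma abs_weightedCdf_sub_Phi_le {a W : ι → ℝ} (ha : ∀ i, 0 ≤ a i) (h1 : ∑ i, a i = 1)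
    {δ η : ℝ} (hδ : 0 < δ) (hη : ∀ y, |∑ i, a i * Phi ((y - W i) / δ) - Phi y| ≤ η) (x₀ : ℝ) :
    |weightedCdf a W x₀ - Phi x₀| ≤ 2 * (3 * δ + η) := by
  set F := weightedCdf a W with hF
  have hbdd : BddAbove (Set.range fun x => |F x - Phi x|) := by
    refine ⟨1, ?_⟩
    rintro _ ⟨x, rfl⟩
    have := weightedCdf_nonneg ha (W := W) x
    have := weightedCdf_le_one ha h1 (W := W) x
    have := Phi_nonneg x
    have := Phi_le_one x
    simp only [abs_le]
    constructor <;> linarith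
  set S := ⨆ x, |F x - Phi x| with hS
  have hle : ∀ x, |F x - Phi x| ≤ S := fun x => le_ciSup hbdd x
  have hS0 : 0 ≤ S := (abs_nonneg _).trans (hle 0)
  have hLip : ∀ x y, Phi x - Phi y ≤ |x - y| := fun x y =>
    (le_abs_self _).trans (abs_Phi_sub_le x y)
  have h_int : ∀ c d : ℝ, Integrable (fun z : ℝ => c + d * z ^ 2) (gaussianReal 0 1) := fun c d =>
    (integrable_const c).add (integrable_sq_gaussianReal.const_mul d)
  have hval : ∀ c d : ℝ, ∫ z : ℝ, (c + d * z ^ 2) ∂(gaussianReal 0 1) = c + d := by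
    intro c d
    rw [integral_add (integrable_const c) (integrable_sq_gaussianReal.const_mul d),
      integral_const_mul, integral_sq_gaussianReal]
    simp
  have key : ∀ x, |F x - Phi x| ≤ S / 2 + (3 * δ + η) := by
    intro x
    have hx := abs_le.1 (hle x)
    rw [abs_le]
    constructor
    · have hpt : ∀ z : ℝ, F ((x - 2 * δ) - δ * z) ≤
          (F x + δ / 2) + (S / 2 + δ / 2) * z ^ 2 := by
        intro z
        by_cases hz : -2 ≤ z
        · have : F ((x - 2 * δ) - δ * z) ≤ F x := weightedCdf_mono ha (by nlinarith)
          nlinarith [mul_nonneg hS0 (sq_nonneg z), mul_nonneg hδ.le (sq_nonneg z)]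
        · push Not at hz
          have h2 := (abs_le.1 (hle ((x - 2 * δ) - δ * z))).2
          have h3 : Phi ((x - 2 * δ) - δ * z) - Phi x ≤ δ * (-z) :=
            (hLip _ _).trans (abs_le.2 ⟨by nlinarith, by nlinarith⟩)
          have h4 : S * 4 ≤ S * z ^ 2 := by apply mul_le_mul_of_nonneg_left _ hS0; nlinarith
          have h5 : δ * (-2 * z) ≤ δ * (z ^ 2 + 1) :=
            mul_le_mul_of_nonneg_left (by nlinarith [sq_nonneg (z + 1)]) hδ.le
          linarith [hx.1]
      have hI := integral_mono (integrable_weightedCdf a W hδ (x - 2 * δ)) (h_int _ _) hpt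
      rw [integral_weightedCdf a W hδ, hval] at hI
      have h6 := (abs_le.1 (hη (x - 2 * δ))).1
      have h7 := hLip x (x - 2 * δ)
      rw [abs_of_nonneg (by linarith)] at h7
      linarith
    · have hpt : ∀ z : ℝ, (F x - δ / 2) + (-(S / 2 + δ / 2)) * z ^ 2 ≤
          F ((x + 2 * δ) - δ * z) := by
        intro z
        by_cases hz : z ≤ 2
        · have : F x ≤ F ((x + 2 * δ) - δ * z) := weightedCdf_mono ha (by nlinarith)
          nlinarith [mul_nonneg hS0 (sq_nonneg z), mul_nonneg hδ.le (sq_nonneg z)]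
        · push Not at hz
          have h2 := (abs_le.1 (hle ((x + 2 * δ) - δ * z))).1
          have h3 : Phi x - Phi ((x + 2 * δ) - δ * z) ≤ δ * z :=
            (hLip _ _).trans (abs_le.2 ⟨by nlinarith, by nlinarith⟩)
          have h4 : S * 4 ≤ S * z ^ 2 := by apply mul_le_mul_of_nonneg_left _ hS0; nlinarith
          have h5 : δ * (2 * z) ≤ δ * (z ^ 2 + 1) :=
            mul_le_mul_of_nonneg_left (by nlinarith [sq_nonneg (z - 1)]) hδ.le
          linarith [hx.2]
      have hI := integral_mono (h_int _ _) (integrable_weightedCdf a W hδ (x + 2 * δ)) hpt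
      rw [integral_weightedCdf a W hδ, hval] at hI
      have h6 := (abs_le.1 (hη (x + 2 * δ))).2
      have h7 := hLip (x + 2 * δ) x
      rw [abs_of_nonneg (by linarith)] at h7
      linarith
  have hfin : S ≤ S / 2 + (3 * δ + η) := ciSup_le key
  linarith [hle x₀]

end Smoothing

section Moments

open scoped PowerSeries

/-- The geometric series `∑ aᵏ Xᵏ`. -/
noncomputable def geomSeries (a : ℝ) : ℝ⟦X⟧ := PowerSeries.mk fun k => a ^ k

lemma one_sub_mul_geomSeries (a : ℝ) :
    (1 - PowerSeries.C a * PowerSeries.X) * geomSeries a = 1 := by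
  ext k
  rw [sub_mul, one_mul, mul_assoc, map_sub, PowerSeries.coeff_C_mul]
  cases k with
  | zero => simp [geomSeries]
  | succ k => simp [geomSeries, PowerSeries.coeff_succ_X_mul, PowerSeries.coeff_one, pow_succ']

lemma derivative_geomSeries (a : ℝ) :
    PowerSeries.derivative ℝ (geomSeries a) =
      geomSeries a * (PowerSeries.C a * geomSeries a) := by
  have h := congrArg (PowerSeries.derivative ℝ) (one_sub_mul_geomSeries a)
  simp only [Derivation.leibniz, map_sub, Derivation.map_one_eq_zero, PowerSeries.derivative_C,
    PowerSeries.derivative_X, smul_eq_mul] at h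
  linear_combination geomSeries a * h - PowerSeries.derivative ℝ (geomSeries a) *
    one_sub_mul_geomSeries a

variable {ι : Type*} [Fintype ι] [DecidableEq ι]

/-- The residue at `x i` of `∏ (z - b j) / ∏ (z - x j)`. -/
noncomputable def residueAt (x b : ι → ℝ) (i : ι) : ℝ :=
  (∏ j, (x i - b j)) / ∏ j ∈ univ.erase i, (x i - x j)

lemma prod_sub_eq_add_sum_residueAt {x : ι → ℝ} (hx : Function.Injective x) (b : ι → ℝ) (z : ℝ) :
    ∏ j, (z - b j) = ∏ j, (z - x j) +
      ∑ i, residueAt x b i * ∏ j ∈ univ.erase i, (z - x j) := by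
  classical
  have hdeg : (Lagrange.nodal univ b - Lagrange.nodal univ x).degree < #(univ : Finset ι) := by
    rw [← Lagrange.degree_nodal (s := univ) (v := b)]
    apply Polynomial.degree_sub_lt_left
    · rw [Lagrange.degree_nodal, Lagrange.degree_nodal]
    · exact Lagrange.nodal_ne_zero
    · rw [(Lagrange.nodal_monic).leadingCoeff, (Lagrange.nodal_monic).leadingCoeff]
  have h := Lagrange.eq_interpolate_of_eval_eq (v := x) (r := fun i => ∏ j, (x i - b j)) hx.injOn
    hdeg (fun i hi => by
      rw [Polynomial.eval_sub, Lagrange.eval_nodal_at_node hi, Lagrange.eval_nodal, sub_zero])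
  rw [Lagrange.interpolate_eq_sum] at h
  have h2 := congrArg (Polynomial.eval z) h
  rw [Polynomial.eval_sub, Lagrange.eval_nodal, Lagrange.eval_nodal, Polynomial.eval_finsetSum]
    at h2
  simp only [Polynomial.eval_mul, Polynomial.eval_C, Polynomial.eval_prod, Polynomial.eval_sub,
    Polynomial.eval_X] at h2
  rw [sub_eq_iff_eq_add'] at h2
  exact h2

lemma polynomial_prod_one_sub {x : ι → ℝ} (hx : Function.Injective x) (b : ι → ℝ) :
    ∏ j, (1 - Polynomial.C (b j) * Polynomial.X) =
      ∏ j, (1 - Polynomial.C (x j) * Polynomial.X) + Polynomial.X * ∑ i,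
        Polynomial.C (residueAt x b i) *
          ∏ j ∈ univ.erase i, (1 - Polynomial.C (x j) * Polynomial.X) := by
  apply Polynomial.eq_of_infinite_eval_eq
  apply Set.Infinite.mono (s := {(0 : ℝ)}ᶜ) _ (Set.finite_singleton _).infinite_compl
  intro t ht
  have ht : t ≠ 0 := ht
  have hz : ∀ (s : Finset ι) (y : ι → ℝ), ∏ j ∈ s, (1 - y j * t) =
      t ^ #s * ∏ j ∈ s, (t⁻¹ - y j) := by
    intro s y
    rw [← Finset.prod_const, ← Finset.prod_mul_distrib]
    apply Finset.prod_congr rfl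
    intro j _
    field_simp
  simp only [Set.mem_ofPred_eq, Polynomial.eval_add, Polynomial.eval_mul, Polynomial.eval_prod,
    Polynomial.eval_finsetSum, Polynomial.eval_sub, Polynomial.eval_one, Polynomial.eval_C,
    Polynomial.eval_X]
  simp only [hz]
  rw [prod_sub_eq_add_sum_residueAt hx b, mul_add, Finset.mul_sum, Finset.mul_sum]
  congr 1
  apply Finset.sum_congr rfl
  intro i hi
  have : #(univ : Finset ι) = #(univ.erase i) + 1 := (Finset.card_erase_add_one hi).symm
  rw [this, pow_succ]
  ring

/-- The expansion at infinity of `∏ (z - b j) / ∏ (z - x j)`. -/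
noncomputable def ratioSeries (x b : ι → ℝ) : ℝ⟦X⟧ :=
  ∏ j, ((1 - PowerSeries.C (b j) * PowerSeries.X) * geomSeries (x j))

lemma ratioSeries_eq {x : ι → ℝ} (hx : Function.Injective x) (b : ι → ℝ) :
    ratioSeries x b = 1 + PowerSeries.X *
      ∑ i, PowerSeries.C (residueAt x b i) * geomSeries (x i) := by
  have h := congrArg (Polynomial.coeToPowerSeries.ringHom (R := ℝ)) (polynomial_prod_one_sub hx b)
  simp only [map_add, map_mul, map_prod, map_sum, map_sub, map_one,
    Polynomial.coeToPowerSeries.ringHom_apply, Polynomial.coe_C, Polynomial.coe_X] at h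
  have hp : ∀ s : Finset ι, (∏ j ∈ s, (1 - PowerSeries.C (x j) * PowerSeries.X)) *
      ∏ j ∈ s, geomSeries (x j) = 1 := by
    intro s
    rw [← Finset.prod_mul_distrib]
    exact Finset.prod_eq_one fun j _ => one_sub_mul_geomSeries _
  rw [ratioSeries, Finset.prod_mul_distrib, h, add_mul, hp, mul_assoc, Finset.sum_mul]
  congr 2
  apply Finset.sum_congr rfl
  intro i hi
  rw [← Finset.mul_prod_erase univ (fun j => geomSeries (x j)) hi]
  linear_combination (PowerSeries.C (residueAt x b i) * geomSeries (x i)) * hp (univ.erase i)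

lemma coeff_zero_ratioSeries {x : ι → ℝ} (hx : Function.Injective x) (b : ι → ℝ) :
    PowerSeries.coeff 0 (ratioSeries x b) = 1 := by
  rw [ratioSeries_eq hx]
  simp

lemma coeff_succ_ratioSeries {x : ι → ℝ} (hx : Function.Injective x) (b : ι → ℝ) (k : ℕ) :
    PowerSeries.coeff (k + 1) (ratioSeries x b) = ∑ i, residueAt x b i * x i ^ k := by
  rw [ratioSeries_eq hx, map_add, PowerSeries.coeff_succ_X_mul]
  simp [PowerSeries.coeff_one, geomSeries]

lemma derivative_ratioSeries (x b : ι → ℝ) :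
    PowerSeries.derivative ℝ (ratioSeries x b) = ratioSeries x b *
      PowerSeries.mk fun k => ∑ j, (x j ^ (k + 1) - b j ^ (k + 1)) := by
  have hmk : (PowerSeries.mk fun k => ∑ j, (x j ^ (k + 1) - b j ^ (k + 1))) =
      ∑ j, (PowerSeries.C (x j) * geomSeries (x j) - PowerSeries.C (b j) * geomSeries (b j)) := by
    ext k
    simp [geomSeries, pow_succ', PowerSeries.coeff_mk]
  rw [hmk, ratioSeries]
  generalize (univ : Finset ι) = s
  induction s using Finset.induction_on with
  | empty => simp
  | insert a s ha ih =>
    rw [Finset.prod_insert ha, Finset.sum_insert ha, Derivation.leibniz, ih]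
    have h1 : PowerSeries.derivative ℝ
        ((1 - PowerSeries.C (b a) * PowerSeries.X) * geomSeries (x a)) =
        (1 - PowerSeries.C (b a) * PowerSeries.X) * geomSeries (x a) *
          (PowerSeries.C (x a) * geomSeries (x a) - PowerSeries.C (b a) * geomSeries (b a)) := by
      rw [Derivation.leibniz, derivative_geomSeries]
      simp only [Derivation.leibniz, map_sub, Derivation.map_one_eq_zero, PowerSeries.derivative_C,
        PowerSeries.derivative_X, smul_eq_mul]
      linear_combination (PowerSeries.C (b a) * geomSeries (x a)) * one_sub_mul_geomSeries (b a)
    rw [h1]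
    simp only [smul_eq_mul]
    ring

/-- Newton-type recursion for the moments of the residues. -/
lemma succ_mul_coeff_ratioSeries (x b : ι → ℝ) (k : ℕ) :
    ((k : ℝ) + 1) * PowerSeries.coeff (k + 1) (ratioSeries x b) =
      ∑ p ∈ Finset.HasAntidiagonal.antidiagonal k, PowerSeries.coeff p.1 (ratioSeries x b) *
        ∑ j, (x j ^ (p.2 + 1) - b j ^ (p.2 + 1)) := by
  have h := congrArg (PowerSeries.coeff k) (derivative_ratioSeries x b)
  rw [PowerSeries.coeff_derivative, PowerSeries.coeff_mul] at h
  simp only [PowerSeries.coeff_mk] at h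
  rw [mul_comm, h]

end Moments

section Vandermonde

variable {N : ℕ}

/-- The product of the differences `v i - v j` over `i < j`. -/
noncomputable def diffProd (v : Fin N → ℝ) : ℝ := ∏ i, ∏ j with i < j, (v i - v j)

lemma exists_diffProd_update (v : Fin N → ℝ) (i : Fin N) :
    ∃ R : ℝ, ∀ a, diffProd (Function.update v i a) = R * ∏ j ∈ univ.erase i, (a - v j) := by
  refine ⟨(∏ j ∈ univ.erase i, if i < j then 1 else -1) *
    ∏ k ∈ univ.erase i, ∏ j ∈ univ.erase i, (if k < j then v k - v j else 1), fun a => ?_⟩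
  set g : Fin N → Fin N → ℝ := fun k j =>
    if k < j then Function.update v i a k - Function.update v i a j else 1 with hg
  have h1 : diffProd (Function.update v i a) = ∏ k, ∏ j, g k j := by
    simp only [diffProd, Finset.prod_filter, hg]
  have h2 : ∀ k, ∏ j, g k j = g k i * ∏ j ∈ univ.erase i, g k j := fun k =>
    (Finset.mul_prod_erase univ (fun j => g k j) (mem_univ i)).symm
  have h3 : g i i = 1 := by simp [hg]
  have h4 : ∏ j ∈ univ.erase i, (a - v j) * (if i < j then 1 else -1) =
      ∏ j ∈ univ.erase i, g i j * g j i := by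
    apply Finset.prod_congr rfl
    intro j hj
    have hne : j ≠ i := Finset.ne_of_mem_erase hj
    rcases lt_or_gt_of_ne hne with h | h
    · simp [hg, h, h.not_gt, hne]
    · simp [hg, h, h.not_gt, hne]
  have h5 : ∏ k ∈ univ.erase i, ∏ j ∈ univ.erase i, (if k < j then v k - v j else 1) =
      ∏ k ∈ univ.erase i, ∏ j ∈ univ.erase i, g k j := by
    apply Finset.prod_congr rfl
    intro k hk
    apply Finset.prod_congr rfl
    intro j hj
    simp [hg, Finset.ne_of_mem_erase hj, Finset.ne_of_mem_erase hk]
  rw [h1, ← Finset.mul_prod_erase univ (fun k => ∏ j, g k j) (mem_univ i), h2 i, h3, one_mul,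
    Finset.prod_congr rfl (fun k _ => h2 k), Finset.prod_mul_distrib, h5]
  rw [Finset.prod_mul_distrib, Finset.prod_mul_distrib] at h4
  linear_combination (-∏ k ∈ univ.erase i, ∏ j ∈ univ.erase i, g k j) * h4

lemma diffProd_update_mul (v : Fin N → ℝ) (i : Fin N) (a : ℝ) :
    diffProd (Function.update v i a) * ∏ j ∈ univ.erase i, (v i - v j) =
      diffProd v * ∏ j ∈ univ.erase i, (a - v j) := by
  obtain ⟨R, hR⟩ := exists_diffProd_update v i
  have := hR (v i)
  rw [Function.update_eq_self] at this
  rw [hR, this]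
  ring

/-- The real-valued version of a tuple of natural numbers. -/
def castTuple (l : Fin N → ℕ) : Fin N → ℝ := fun i => (l i : ℝ)

lemma castTuple_update (l : Fin N → ℕ) (i : Fin N) (a : ℕ) :
    castTuple (Function.update l i a) = Function.update (castTuple l) i (a : ℝ) := by
  ext j
  by_cases h : j = i
  · subst h; simp [castTuple]
  · simp [castTuple, h]

lemma castTuple_injective {l : Fin N → ℕ} (hl : StrictAnti l) :
    Function.Injective (castTuple l) := fun i j h =>
  hl.injective (by simpa [castTuple] using h)

lemma prod_erase_castTuple_ne_zero {l : Fin N → ℕ} (hl : StrictAnti l) (i : Fin N) :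
    ∏ j ∈ univ.erase i, (castTuple l i - castTuple l j) ≠ 0 := by
  rw [Finset.prod_ne_zero_iff]
  intro j hj
  rw [sub_ne_zero]
  exact fun h => Finset.ne_of_mem_erase hj (castTuple_injective hl h).symm

lemma diffProd_nonneg {l : Fin N → ℕ} (hl : Antitone l) : 0 ≤ diffProd (castTuple l) :=
  Finset.prod_nonneg fun i _ => Finset.prod_nonneg fun j hj => by
    have := hl (Finset.mem_filter.1 hj).2.le
    simpa [castTuple] using this

lemma diffProd_pos {l : Fin N → ℕ} (hl : StrictAnti l) : 0 < diffProd (castTuple l) :=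
  Finset.prod_pos fun i _ => Finset.prod_pos fun j hj => by
    have := hl (Finset.mem_filter.1 hj).2
    simpa [castTuple] using this

lemma ne_of_diffProd_ne_zero {l : Fin N → ℕ} (h : diffProd (castTuple l) ≠ 0) {i j : Fin N}
    (hij : i < j) : l i ≠ l j := by
  rw [diffProd, Finset.prod_ne_zero_iff] at h
  have h1 := h i (mem_univ i)
  rw [Finset.prod_ne_zero_iff] at h1
  have h2 := h1 j (by simpa using hij)
  intro h3
  simp [castTuple, h3] at h2

/-- Adding a box in row `i`. -/
def addBox (l : Fin N → ℕ) (i : Fin N) : Fin N → ℕ := Function.update l i (l i + 1)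

/-- Removing a box from row `i`. -/
def removeBox (l : Fin N → ℕ) (i : Fin N) : Fin N → ℕ := Function.update l i (l i - 1)

lemma removeBox_addBox (l : Fin N → ℕ) (i : Fin N) : removeBox (addBox l i) i = l := by
  simp [removeBox, addBox]

lemma addBox_removeBox {l : Fin N → ℕ} {i : Fin N} (h : l i ≠ 0) :
    addBox (removeBox l i) i = l := by
  simp [removeBox, addBox, Nat.sub_add_cancel (Nat.one_le_iff_ne_zero.2 h)]

lemma addBox_apply (l : Fin N → ℕ) (i j : Fin N) :
    addBox l i j = if j = i then l j + 1 else l j := by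
  by_cases h : j = i
  · subst h; simp [addBox]
  · simp [addBox, h]

lemma removeBox_apply (l : Fin N → ℕ) (i j : Fin N) :
    removeBox l i j = if j = i then l j - 1 else l j := by
  by_cases h : j = i
  · subst h; simp [removeBox]
  · simp [removeBox, h]

lemma antitone_addBox {l : Fin N → ℕ} (hl : StrictAnti l) (i : Fin N) : Antitone (addBox l i) := by
  intro a b hab
  rcases hab.eq_or_lt with rfl | h
  · exact le_rfl
  · have := hl h
    simp only [addBox_apply]
    split_ifs <;> omega

lemma antitone_removeBox {l : Fin N → ℕ} (hl : StrictAnti l) (i : Fin N) :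
    Antitone (removeBox l i) := by
  intro a b hab
  rcases hab.eq_or_lt with rfl | h
  · exact le_rfl
  · have := hl h
    simp only [removeBox_apply]
    split_ifs <;> omega

lemma strictAnti_of_diffProd_ne_zero {l : Fin N → ℕ} (hl : Antitone l)
    (h : diffProd (castTuple l) ≠ 0) : StrictAnti l := fun _ _ hab =>
  lt_of_le_of_ne (hl hab.le) (ne_of_diffProd_ne_zero h hab).symm

lemma sum_addBox (l : Fin N → ℕ) (i : Fin N) : ∑ j, addBox l i j = ∑ j, l j + 1 := by
  simp only [addBox_apply]
  rw [← Finset.add_sum_erase univ _ (mem_univ i), ← Finset.add_sum_erase univ l (mem_univ i)]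
  rw [Finset.sum_congr rfl (fun j hj => if_neg (Finset.ne_of_mem_erase hj))]
  simp
  ring

lemma prod_factorial_addBox (l : Fin N → ℕ) (i : Fin N) :
    ∏ j, ((addBox l i j).factorial : ℝ) = (l i + 1) * ∏ j, ((l j).factorial : ℝ) := by
  rw [← Finset.mul_prod_erase univ _ (mem_univ i),
    ← Finset.mul_prod_erase univ (fun j => ((l j).factorial : ℝ)) (mem_univ i)]
  rw [Finset.prod_congr rfl (g := fun j => ((l j).factorial : ℝ))
    (fun j hj => by rw [addBox_apply, if_neg (Finset.ne_of_mem_erase hj)])]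
  simp [addBox_apply, Nat.factorial_succ]
  ring

/-- The strictly decreasing tuples `λ i + N - 1 - i` attached to partitions of `k`. -/
def shiftedShapes (N k : ℕ) : Finset (Fin N → ℕ) :=
  open Classical in (piAntidiag univ (k + N.choose 2)).filter StrictAnti

lemma mem_shiftedShapes {k : ℕ} {l : Fin N → ℕ} :
    l ∈ shiftedShapes N k ↔ ∑ i, l i = k + N.choose 2 ∧ StrictAnti l := by
  simp [shiftedShapes]

/-- The Plancherel weight. -/
noncomputable def plancherelWeight (k : ℕ) (l : Fin N → ℕ) : ℝ :=
  k.factorial * (diffProd (castTuple l) / ∏ i, ((l i).factorial : ℝ)) ^ 2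

/-- The transition probability of Plancherel growth. -/
noncomputable def growthProb (l : Fin N → ℕ) (i : Fin N) : ℝ :=
  diffProd (castTuple (addBox l i)) / (diffProd (castTuple l) * (l i + 1))

lemma growthProb_nonneg {l : Fin N → ℕ} (hl : StrictAnti l) (i : Fin N) : 0 ≤ growthProb l i :=
  div_nonneg (diffProd_nonneg (antitone_addBox hl i))
    (mul_nonneg (diffProd_pos hl).le (by positivity))

/-- The branching identity for the number of standard tableaux. -/
lemma sum_mul_diffProd_removeBox {l : Fin N → ℕ} (hl : StrictAnti l) :
    ∑ i, (l i : ℝ) * diffProd (castTuple (removeBox l i)) =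
      (∑ i, (l i : ℝ) - N * (N - 1) / 2) * diffProd (castTuple l) := by
  set x := castTuple l with hx
  have hinj := castTuple_injective hl
  set b : Fin N → ℝ := fun j => x j + 1 with hb
  have h0 := coeff_zero_ratioSeries hinj b
  have h1 := succ_mul_coeff_ratioSeries x b 0
  have h2 := succ_mul_coeff_ratioSeries x b 1
  simp only [Finset.Nat.antidiagonal_succ, Finset.HasAntidiagonal.antidiagonal_zero,
    Finset.sum_cons, Finset.sum_map, Finset.sum_singleton] at h1 h2
  have hp1 : ∑ j, (x j ^ (0 + 1) - b j ^ (0 + 1)) = -(N : ℝ) := by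
    simp [hb]
  have hp2 : ∑ j, (x j ^ (1 + 1) - b j ^ (1 + 1)) = -2 * ∑ j, x j - N := by
    simp only [hb]
    rw [Finset.mul_sum, Finset.sum_congr rfl (g := fun j => -2 * x j - 1) (fun j _ => by ring),
      Finset.sum_sub_distrib]
    simp
  have hterm : ∀ i, (l i : ℝ) * diffProd (castTuple (removeBox l i)) =
      -(residueAt x b i * x i ^ 1) * diffProd x := by
    intro i
    by_cases hli : l i = 0
    · simp [hli, hx, castTuple]
    · have hcast : ((l i - 1 : ℕ) : ℝ) = x i - 1 := by
        rw [Nat.cast_sub (Nat.one_le_iff_ne_zero.2 hli)]; simp [hx, castTuple]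
      have h3 := diffProd_update_mul x i (x i - 1)
      have h4 := prod_erase_castTuple_ne_zero hl i
      rw [← hx] at h4
      rw [removeBox, castTuple_update, hcast, ← hx, residueAt,
        ← Finset.mul_prod_erase univ (fun j => x i - b j) (mem_univ i)]
      have h5 : ∏ j ∈ univ.erase i, (x i - b j) = ∏ j ∈ univ.erase i, (x i - 1 - x j) :=
        Finset.prod_congr rfl fun j _ => by simp only [hb]; ring
      rw [h5]
      have h6 : x i - b i = -1 := by simp [hb]
      rw [h6]
      have h7 : (l i : ℝ) = x i := rfl
      rw [h7]
      field_simp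
      linear_combination (x i) * h3
  rw [Finset.sum_congr rfl fun i _ => hterm i, ← Finset.sum_mul, Finset.sum_neg_distrib,
    ← coeff_succ_ratioSeries hinj b 1]
  congr 1
  simp at h0 h1 h2
  simp at hp1 hp2
  rw [h0] at h1 h2
  rw [hp1] at h1 h2
  norm_num at h2
  rw [hp2, h1] at h2
  have h8 : ∑ i, (l i : ℝ) = ∑ i, x i := rfl
  rw [h8]
  norm_num
  linarith

/-- Expectation under the Plancherel weights at level `k`. -/
noncomputable def plancherelMean (N k : ℕ) (f : (Fin N → ℕ) → ℝ) : ℝ :=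
  ∑ l ∈ shiftedShapes N k, plancherelWeight k l * f l

lemma plancherelMean_succ (k : ℕ) (f : (Fin N → ℕ) → ℝ) :
    plancherelMean N (k + 1) f =
      plancherelMean N k fun l => ∑ i, growthProb l i * f (addBox l i) := by
  set A : (Fin N → ℕ) × Fin N → ℝ := fun q =>
    k.factorial * (diffProd (castTuple q.1) * diffProd (castTuple (addBox q.1 q.2)) /
      ((∏ j, ((q.1 j).factorial : ℝ)) * ∏ j, ((addBox q.1 q.2 j).factorial : ℝ))) *
      f (addBox q.1 q.2) with hA
  set B : (Fin N → ℕ) × Fin N → ℝ := fun q =>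
    k.factorial * ((q.1 q.2 : ℝ) * diffProd (castTuple (removeBox q.1 q.2)) *
      diffProd (castTuple q.1) / (∏ j, ((q.1 j).factorial : ℝ)) ^ 2) * f q.1 with hB
  have hR : (plancherelMean N k fun l => ∑ i, growthProb l i * f (addBox l i)) =
      ∑ q ∈ shiftedShapes N k ×ˢ univ, A q := by
    rw [Finset.sum_product, plancherelMean]
    apply Finset.sum_congr rfl
    intro l hl
    rw [Finset.mul_sum]
    apply Finset.sum_congr rfl
    intro i _
    have hV := (diffProd_pos (mem_shiftedShapes.1 hl).2).ne'
    have hF : (∏ j, ((l j).factorial : ℝ)) ≠ 0 :=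
      Finset.prod_ne_zero_iff.2 fun j _ => by positivity
    have hli : (l i : ℝ) + 1 ≠ 0 := by positivity
    simp only [hA, plancherelWeight, growthProb, prod_factorial_addBox]
    field_simp
  have hL : plancherelMean N (k + 1) f = ∑ q ∈ shiftedShapes N (k + 1) ×ˢ univ, B q := by
    rw [Finset.sum_product, plancherelMean]
    apply Finset.sum_congr rfl
    intro l hl
    have hl' := mem_shiftedShapes.1 hl
    have h1 := sum_mul_diffProd_removeBox hl'.2
    have h2 : (∑ i, (l i : ℝ)) = (k + 1) + N * (N - 1) / 2 := by
      rw [← Nat.cast_choose_two]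
      exact_mod_cast hl'.1
    rw [h2, add_sub_cancel_right] at h1
    simp only [hB, plancherelWeight]
    rw [← Finset.sum_mul, ← Finset.mul_sum, ← Finset.sum_div, ← Finset.sum_mul, h1,
      Nat.factorial_succ]
    push_cast
    ring
  rw [hR, hL]
  symm
  refine Finset.sum_bij_ne_zero (fun q _ _ => (addBox q.1 q.2, q.2)) ?_ ?_ ?_ ?_
  · rintro ⟨l, i⟩ hq hne
    have hl := mem_shiftedShapes.1 (Finset.mem_product.1 hq).1
    have hV : diffProd (castTuple (addBox l i)) ≠ 0 := by
      intro h
      apply hne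
      simp [hA, h]
    refine Finset.mem_product.2 ⟨mem_shiftedShapes.2 ⟨?_, ?_⟩, mem_univ _⟩
    · simp only [sum_addBox]
      have := hl.1
      simp only at this
      omega
    · exact strictAnti_of_diffProd_ne_zero (antitone_addBox hl.2 i) hV
  · rintro ⟨l, i⟩ _ _ ⟨l', i'⟩ _ _ h
    simp only [Prod.mk.injEq] at h
    obtain ⟨h, rfl⟩ := h
    rw [← removeBox_addBox l i, h, removeBox_addBox]
  · rintro ⟨l, i⟩ hq hne
    have hl := mem_shiftedShapes.1 (Finset.mem_product.1 hq).1
    have hV : diffProd (castTuple (removeBox l i)) ≠ 0 := by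
      intro h
      apply hne
      simp [hB, h]
    have hli : l i ≠ 0 := by
      intro h
      apply hne
      simp [hB, h]
    have hb := addBox_removeBox hli
    have hVl : diffProd (castTuple l) ≠ 0 := (diffProd_pos hl.2).ne'
    have hfl : f l ≠ 0 := by
      intro h
      apply hne
      simp [hB, h]
    refine ⟨(removeBox l i, i), Finset.mem_product.2 ⟨mem_shiftedShapes.2 ⟨?_, ?_⟩, mem_univ _⟩,
      ?_, ?_⟩
    · have h1 := sum_addBox (removeBox l i) i
      rw [hb] at h1
      have := hl.1
      simp only at this ⊢
      omega
    · exact strictAnti_of_diffProd_ne_zero (antitone_removeBox hl.2 i) hV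
    · simp only [hA, hb]
      have h1 : (∏ j, ((l j).factorial : ℝ)) ≠ 0 :=
        Finset.prod_ne_zero_iff.2 fun j _ => by positivity
      have h2 : (∏ j, ((removeBox l i j).factorial : ℝ)) ≠ 0 :=
        Finset.prod_ne_zero_iff.2 fun j _ => by positivity
      positivity
    · simp only [hb]
  · rintro ⟨l, i⟩ hq hne
    have h1 : (∏ j, ((l j).factorial : ℝ)) ≠ 0 :=
      Finset.prod_ne_zero_iff.2 fun j _ => by positivity
    have hli : (l i : ℝ) + 1 ≠ 0 := by positivity
    simp only [hA, hB, removeBox_addBox, prod_factorial_addBox]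
    simp only [addBox_apply, if_true]
    push_cast
    field_simp

end Vandermonde

section Transition

variable {N : ℕ}

/-- The content of the box added to row `i`. -/
noncomputable def boxContent (l : Fin N → ℕ) (i : Fin N) : ℝ := l i + 1 - N

lemma boxContent_injective {l : Fin N → ℕ} (hl : StrictAnti l) :
    Function.Injective (boxContent l) := fun i j h =>
  hl.injective (by simpa [boxContent] using h)

lemma residueAt_boxContent {l : Fin N → ℕ} (hl : StrictAnti l) {j₀ : Fin N} (h0 : l j₀ = 0)
    (c : ℝ) (i : Fin N) :
    residueAt (boxContent l) (Function.update (fun j => boxContent l j - 1) j₀ c) i =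
      (boxContent l i - c) * growthProb l i := by
  have h1 := diffProd_update_mul (castTuple l) i ((l i : ℝ) + 1)
  have h2 : castTuple (addBox l i) = Function.update (castTuple l) i ((l i : ℝ) + 1) := by
    rw [addBox, castTuple_update, Nat.cast_add_one]
  rw [← h2] at h1
  have h3 : ∏ j ∈ univ.erase i, (boxContent l i - boxContent l j) =
      ∏ j ∈ univ.erase i, (castTuple l i - castTuple l j) :=
    Finset.prod_congr rfl fun j _ => by simp [boxContent, castTuple]
  have h4 : ∏ j, (boxContent l i - Function.update (fun j => boxContent l j - 1) j₀ c j) =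
      (boxContent l i - c) * ∏ j ∈ univ.erase j₀, ((l i : ℝ) + 1 - castTuple l j) := by
    rw [← Finset.mul_prod_erase univ _ (mem_univ j₀), Function.update_self]
    congr 1
    apply Finset.prod_congr rfl
    intro j hj
    rw [Function.update_of_ne (Finset.ne_of_mem_erase hj)]
    simp only [boxContent, castTuple]
    ring
  have h5 : ((l i : ℝ) + 1) * ∏ j ∈ univ.erase j₀, ((l i : ℝ) + 1 - castTuple l j) =
      ∏ j ∈ univ.erase i, ((l i : ℝ) + 1 - castTuple l j) := by
    have h6 := Finset.mul_prod_erase univ (fun j => (l i : ℝ) + 1 - castTuple l j) (mem_univ j₀)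
    have h7 := Finset.mul_prod_erase univ (fun j => (l i : ℝ) + 1 - castTuple l j) (mem_univ i)
    simp only [castTuple, h0, Nat.cast_zero, sub_zero, add_sub_cancel_left, one_mul] at h6 h7 ⊢
    rw [h6, h7]
  have h8 := prod_erase_castTuple_ne_zero hl i
  have h9 : (l i : ℝ) + 1 ≠ 0 := by positivity
  have h10 := (diffProd_pos hl).ne'
  rw [residueAt, h3, h4, growthProb]
  field_simp
  rw [← h5] at h1
  linear_combination -(boxContent l i - c) * h1

/-- The fourth power sum governing the fourth moment of the transition measure. -/
noncomputable def fourthPowerSum (l : Fin N → ℕ) : ℝ :=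
  ∑ j, (boxContent l j ^ 4 - (boxContent l j - 1) ^ 4) + (N : ℝ) ^ 4

lemma sum_pow_sub_update {l : Fin N → ℕ} {j₀ : Fin N} (h0 : l j₀ = 0) (c : ℝ) (k : ℕ) :
    ∑ j, (boxContent l j ^ k - Function.update (fun j => boxContent l j - 1) j₀ c j ^ k) =
      ∑ j, (boxContent l j ^ k - (boxContent l j - 1) ^ k) + (-(N : ℝ)) ^ k - c ^ k := by
  rw [← Finset.add_sum_erase univ _ (mem_univ j₀),
    ← Finset.add_sum_erase univ (fun j => boxContent l j ^ k - (boxContent l j - 1) ^ k)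
      (mem_univ j₀), Function.update_self,
    Finset.sum_congr rfl fun j hj => by
      rw [Function.update_of_ne (Finset.ne_of_mem_erase hj)]]
  have : boxContent l j₀ - 1 = -(N : ℝ) := by simp [boxContent, h0]
  rw [this]
  ring

lemma sum_growthProb {l : Fin N → ℕ} (hl : StrictAnti l) {j₀ : Fin N} (h0 : l j₀ = 0) (c : ℝ) :
    ∑ i, (boxContent l i - c) * growthProb l i = -c := by
  have h1 := succ_mul_coeff_ratioSeries (boxContent l)
    (Function.update (fun j => boxContent l j - 1) j₀ c) 0
  rw [coeff_succ_ratioSeries (boxContent_injective hl)] at h1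
  simp only [Finset.HasAntidiagonal.antidiagonal_zero, Finset.sum_singleton,
    coeff_zero_ratioSeries (boxContent_injective hl), sum_pow_sub_update h0,
    residueAt_boxContent hl h0] at h1
  simpa using h1

lemma sum_growthProb_eq_one {l : Fin N → ℕ} (hl : StrictAnti l) {j₀ : Fin N} (h0 : l j₀ = 0) :
    ∑ i, growthProb l i = 1 := by
  have h1 := sum_growthProb hl h0 0
  have h2 := sum_growthProb hl h0 1
  simp only [sub_mul, one_mul, sub_zero, Finset.sum_sub_distrib] at h1 h2
  linarith

lemma sum_growthProb_mul_content {l : Fin N → ℕ} (hl : StrictAnti l) {j₀ : Fin N}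
    (h0 : l j₀ = 0) : ∑ i, growthProb l i * boxContent l i = 0 := by
  have h1 := sum_growthProb hl h0 0
  simp only [sub_zero, neg_zero] at h1
  rw [← h1]
  exact Finset.sum_congr rfl fun i _ => mul_comm _ _

lemma growthProb_moments {l : Fin N → ℕ} (hl : StrictAnti l) {j₀ : Fin N} (h0 : l j₀ = 0)
    {k : ℕ} (hk : ∑ i, l i = k + N.choose 2) :
    ∑ i, growthProb l i * boxContent l i ^ 2 = k ∧
      ∑ i, growthProb l i * boxContent l i ^ 4 = fourthPowerSum l / 4 + (k : ℝ) ^ 2 / 2 := by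
  set b := Function.update (fun j => boxContent l j - 1) j₀ (0 : ℝ)
  have hinj := boxContent_injective hl
  have hm : ∀ q : ℕ, PowerSeries.coeff (q + 1) (ratioSeries (boxContent l) b) =
      ∑ i, growthProb l i * boxContent l i ^ (q + 1) := by
    intro q
    rw [coeff_succ_ratioSeries hinj]
    apply Finset.sum_congr rfl
    intro i _
    rw [residueAt_boxContent hl h0]
    ring
  have h2 := succ_mul_coeff_ratioSeries (boxContent l) b 1
  have h4 := succ_mul_coeff_ratioSeries (boxContent l) b 3
  have hP : ∀ q, ∑ j, (boxContent l j ^ q - b j ^ q) = _ := sum_pow_sub_update h0 0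
  have hc0 := coeff_zero_ratioSeries hinj b
  have hc1 := sum_growthProb_mul_content hl h0
  simp only [Finset.Nat.antidiagonal_succ, Finset.HasAntidiagonal.antidiagonal_zero,
    Finset.sum_cons, Finset.sum_singleton, hm, hP, Function.Embedding.prodMap,
    Finset.map_cons, Finset.map_singleton, Function.Embedding.coeFn_mk, Prod.map,
    Function.Embedding.refl_apply, Nat.succ_eq_add_one, hc0] at h2 h4
  have hQ2 : ∑ j, (boxContent l j ^ 2 - (boxContent l j - 1) ^ 2) = 2 * k - (N : ℝ) ^ 2 := by
    rw [Finset.sum_congr rfl (g := fun j => 2 * (l j : ℝ) + (1 - 2 * (N : ℝ)))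
      (fun j _ => by simp only [boxContent]; ring), Finset.sum_add_distrib, ← Finset.mul_sum]
    have : ∑ i, (l i : ℝ) = k + N * (N - 1) / 2 := by
      rw [← Nat.cast_choose_two]
      exact_mod_cast hk
    rw [this]
    simp
    ring
  norm_num [hc1] at h2 h4
  rw [Finset.sum_sub_distrib] at hQ2
  have hm2 : ∑ i, growthProb l i * boxContent l i ^ 2 = k := by linarith
  refine ⟨hm2, ?_⟩
  rw [fourthPowerSum, Finset.sum_sub_distrib]
  rw [hm2] at h4
  linear_combination (1 / 4) * h4 + (k : ℝ) / 4 * hQ2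

lemma boxContent_addBox (l : Fin N → ℕ) (i j : Fin N) :
    boxContent (addBox l i) j = if j = i then boxContent l j + 1 else boxContent l j := by
  simp only [boxContent, addBox_apply]
  split_ifs
  · push_cast; ring
  · rfl

lemma sum_boxContent_addBox (φ : ℝ → ℝ) (l : Fin N → ℕ) (i : Fin N) :
    ∑ j, φ (boxContent (addBox l i) j) =
      ∑ j, φ (boxContent l j) + (φ (boxContent l i + 1) - φ (boxContent l i)) := by
  rw [← Finset.add_sum_erase univ _ (mem_univ i),
    ← Finset.add_sum_erase univ (fun j => φ (boxContent l j)) (mem_univ i),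
    Finset.sum_congr rfl (g := fun j => φ (boxContent l j))
      fun j hj => by rw [boxContent_addBox, if_neg (Finset.ne_of_mem_erase hj)],
    boxContent_addBox, if_pos rfl]
  ring

lemma fourthPowerSum_addBox (l : Fin N → ℕ) (i : Fin N) :
    fourthPowerSum (addBox l i) = fourthPowerSum l + (12 * boxContent l i ^ 2 + 2) := by
  rw [fourthPowerSum, sum_boxContent_addBox fun t => t ^ 4 - (t - 1) ^ 4, fourthPowerSum]
  ring

/-- The sum of the contents of all boxes. -/
noncomputable def contentSum (l : Fin N → ℕ) : ℝ :=
  ∑ i, (boxContent l i * (boxContent l i - 1) - (i : ℝ) * (i + 1)) / 2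

lemma contentSum_addBox (l : Fin N → ℕ) (i : Fin N) :
    contentSum (addBox l i) = contentSum l + boxContent l i := by
  simp only [contentSum, sub_div, Finset.sum_sub_distrib]
  rw [sum_boxContent_addBox fun t => t * (t - 1) / 2]
  ring

lemma add_sub_le_of_strictAnti {l : Fin N → ℕ} (hl : StrictAnti l) {i j : Fin N} (hij : i ≤ j) :
    l j + (j - i : ℕ) ≤ l i := by
  obtain ⟨d, hd⟩ : ∃ d, (j : ℕ) = i + d := Nat.exists_eq_add_of_le hij
  induction d generalizing j with
  | zero =>
    have : j = i := Fin.ext (by simpa using hd)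
    simp [this]
  | succ d ih =>
    have hj := j.isLt
    have h1 := ih (j := ⟨i + d, by omega⟩) (Fin.mk_le_mk.2 (by omega)) rfl
    have h2 := hl (a := ⟨i + d, by omega⟩) (b := j) (Fin.lt_def.2 (by simp only; omega))
    simp only at h1
    omega

lemma sub_le_of_strictAnti {l : Fin N → ℕ} (hl : StrictAnti l) (i : Fin N) :
    N - 1 - i ≤ l i := by
  have hi := i.isLt
  have := add_sub_le_of_strictAnti hl (i := i) (j := ⟨N - 1, by omega⟩)
    (Fin.le_def.2 (by simp only; omega))
  simp only at this
  omega

lemma sum_sub_eq_choose_two : ∑ i : Fin N, (N - 1 - (i : ℕ)) = N.choose 2 := by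
  rw [Fin.sum_univ_eq_sum_range fun i => N - 1 - i, Finset.sum_range_reflect fun i => i,
    Finset.sum_range_id, Nat.choose_two_right]

lemma exists_eq_zero_of_mem_shiftedShapes {k : ℕ} (hk : k < N) {l : Fin N → ℕ}
    (hl : l ∈ shiftedShapes N k) : ∃ j, l j = 0 := by
  by_contra! h
  obtain ⟨hsum, hl⟩ := mem_shiftedShapes.1 hl
  have h1 : ∀ i : Fin N, N - 1 - (i : ℕ) + 1 ≤ l i := by
    intro i
    have hi := i.isLt
    have h2 := add_sub_le_of_strictAnti hl (i := i) (j := ⟨N - 1, by omega⟩)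
      (Fin.le_def.2 (by simp only; omega))
    have h3 := h ⟨N - 1, by omega⟩
    simp only at h2
    omega
  have h2 := Finset.sum_le_sum fun i (_ : i ∈ univ) => h1 i
  rw [Finset.sum_add_distrib, sum_sub_eq_choose_two, hsum] at h2
  simp at h2
  omega

lemma prod_eq_factorial_of_injOn {ι : Type*} {M : ℕ} {s : Finset ι} {f : ι → ℕ} (hf : Set.InjOn f s)
    (hs : #s = M) (hmem : ∀ i ∈ s, 1 ≤ f i ∧ f i ≤ M) : ∏ i ∈ s, f i = M.factorial := by
  rw [← Finset.prod_Ico_id_eq_factorial, ← Finset.prod_image (f := fun x => x) hf]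
  congr 1
  apply Finset.eq_of_subset_of_card_le
  · intro x hx
    obtain ⟨i, hi, rfl⟩ := Finset.mem_image.1 hx
    have := hmem i hi
    exact Finset.mem_Ico.2 (by omega)
  · rw [Finset.card_image_of_injOn hf, hs]
    simp

/-- The shifted tuple of the empty partition. -/
def emptyShape (N : ℕ) : Fin N → ℕ := fun i => N - 1 - i

lemma strictAnti_emptyShape : StrictAnti (emptyShape N) := fun i j h => by
  have := j.isLt
  have := Fin.lt_def.1 h
  simp only [emptyShape]
  omega

lemma shiftedShapes_zero : shiftedShapes N 0 = {emptyShape N} := by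
  ext l
  rw [mem_shiftedShapes, Finset.mem_singleton, zero_add]
  constructor
  · rintro ⟨hs, hl⟩
    rw [← sum_sub_eq_choose_two, eq_comm,
      Finset.sum_eq_sum_iff_of_le fun i _ => sub_le_of_strictAnti hl i] at hs
    exact funext fun i => (hs i (mem_univ i)).symm
  · rintro rfl
    exact ⟨sum_sub_eq_choose_two, strictAnti_emptyShape⟩

lemma boxContent_emptyShape (i : Fin N) : boxContent (emptyShape N) i = -i := by
  have := i.isLt
  simp only [boxContent, emptyShape]
  rw [Nat.cast_sub (by omega), Nat.cast_sub (by omega)]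
  push_cast
  ring

lemma contentSum_emptyShape : contentSum (emptyShape N) = 0 := by
  simp only [contentSum, boxContent_emptyShape]
  exact Finset.sum_eq_zero fun i _ => by ring

lemma fourthPowerSum_emptyShape : fourthPowerSum (emptyShape N) = 0 := by
  simp only [fourthPowerSum, boxContent_emptyShape]
  rw [Fin.sum_univ_eq_sum_range fun i => (-(i : ℝ)) ^ 4 - (-(i : ℝ) - 1) ^ 4,
    Finset.sum_congr rfl (g := fun i : ℕ => (i : ℝ) ^ 4 - ((i + 1 : ℕ) : ℝ) ^ 4)
      fun i _ => by push_cast; ring, Finset.sum_range_sub']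
  simp

lemma plancherelWeight_emptyShape : plancherelWeight 0 (emptyShape N) = 1 := by
  have h : diffProd (castTuple (emptyShape N)) = ∏ i, ((emptyShape N i).factorial : ℝ) := by
    apply Finset.prod_congr rfl
    intro i _
    have h1 : ∀ j ∈ univ.filter (i < ·), castTuple (emptyShape N) i - castTuple (emptyShape N) j =
        ((j - i : ℕ) : ℝ) := by
      intro j hj
      have h2 : (i : ℕ) < j := (Finset.mem_filter.1 hj).2
      have h3 := boxContent_emptyShape i
      have h4 := boxContent_emptyShape j
      simp only [boxContent, castTuple] at *
      rw [Nat.cast_sub h2.le]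
      linarith
    rw [Finset.prod_congr rfl h1, ← Nat.cast_prod]
    congr 1
    have h5 := i.isLt
    apply prod_eq_factorial_of_injOn
    · intro a ha b hb hab
      have ha : i < a := (Finset.mem_filter.1 ha).2
      have hb : i < b := (Finset.mem_filter.1 hb).2
      simp only at hab
      exact Fin.ext (by omega)
    · rw [Finset.filter_lt_eq_Ioi, Fin.card_Ioi]
      rfl
    · intro a ha
      have ha : i < a := (Finset.mem_filter.1 ha).2
      have := a.isLt
      simp only [emptyShape]
      omega
  rw [plancherelWeight, h, div_self]
  · simp
  · exact Finset.prod_ne_zero_iff.2 fun j _ => by positivity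

lemma plancherelMean_zero (f : (Fin N → ℕ) → ℝ) : plancherelMean N 0 f = f (emptyShape N) := by
  rw [plancherelMean, shiftedShapes_zero, Finset.sum_singleton, plancherelWeight_emptyShape,
    one_mul]

lemma plancherelMean_congr {k : ℕ} {f g : (Fin N → ℕ) → ℝ}
    (h : ∀ l ∈ shiftedShapes N k, f l = g l) : plancherelMean N k f = plancherelMean N k g :=
  Finset.sum_congr rfl fun l hl => by rw [h l hl]

lemma plancherelWeight_nonneg (k : ℕ) (l : Fin N → ℕ) : 0 ≤ plancherelWeight k l := by
  unfold plancherelWeight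
  positivity

lemma plancherelMean_mono {k : ℕ} {f g : (Fin N → ℕ) → ℝ}
    (h : ∀ l ∈ shiftedShapes N k, f l ≤ g l) : plancherelMean N k f ≤ plancherelMean N k g :=
  Finset.sum_le_sum fun l hl => mul_le_mul_of_nonneg_left (h l hl) (plancherelWeight_nonneg k l)

lemma plancherelMean_add (k : ℕ) (f g : (Fin N → ℕ) → ℝ) :
    plancherelMean N k (fun l => f l + g l) = plancherelMean N k f + plancherelMean N k g := by
  simp only [plancherelMean, mul_add, Finset.sum_add_distrib]

lemma plancherelMean_const_mul (k : ℕ) (c : ℝ) (f : (Fin N → ℕ) → ℝ) :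
    plancherelMean N k (fun l => c * f l) = c * plancherelMean N k f := by
  simp only [plancherelMean, Finset.mul_sum]
  exact Finset.sum_congr rfl fun l _ => by ring

lemma plancherelMean_one {k : ℕ} (hk : k ≤ N) : plancherelMean N k (fun _ => 1) = 1 := by
  induction k with
  | zero => exact plancherelMean_zero _
  | succ k ih =>
    rw [plancherelMean_succ]
    refine Eq.trans ?_ (ih (by omega))
    apply plancherelMean_congr
    intro l hl
    obtain ⟨j, hj⟩ := exists_eq_zero_of_mem_shiftedShapes hk hl
    simpa using sum_growthProb_eq_one (mem_shiftedShapes.1 hl).2 hj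

lemma plancherelMean_const {k : ℕ} (hk : k ≤ N) (c : ℝ) : plancherelMean N k (fun _ => c) = c := by
  have := plancherelMean_const_mul k c (fun _ : Fin N → ℕ => 1)
  simpa [plancherelMean_one hk] using this

lemma plancherelMean_fourthPowerSum {k : ℕ} (hk : k ≤ N) :
    plancherelMean N k fourthPowerSum = 6 * k * (k - 1) + 2 * k := by
  induction k with
  | zero => simp [plancherelMean_zero, fourthPowerSum_emptyShape]
  | succ k ih =>
    rw [plancherelMean_succ, plancherelMean_congr (g := fun l => fourthPowerSum l + (12 * k + 2)),
      plancherelMean_add, ih (by omega), plancherelMean_const (by omega)]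
    · push_cast
      ring
    · intro l hl
      obtain ⟨j, hj⟩ := exists_eq_zero_of_mem_shiftedShapes hk hl
      obtain ⟨hs, hl⟩ := mem_shiftedShapes.1 hl
      have h1 := sum_growthProb_eq_one hl hj
      have h2 := (growthProb_moments hl hj hs).1
      simp only [fourthPowerSum_addBox]
      rw [← h2, Finset.mul_sum]
      calc _ = ∑ i, (growthProb l i * (fourthPowerSum l + 2) +
            12 * (growthProb l i * boxContent l i ^ 2)) :=
            Finset.sum_congr rfl fun i _ => by ring
        _ = _ := by
            rw [Finset.sum_add_distrib, ← Finset.sum_mul, h1]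
            ring

lemma plancherelMean_fourth_moment_le {k : ℕ} (hk : k < N) :
    plancherelMean N k (fun l => ∑ i, growthProb l i * boxContent l i ^ 4) ≤ 2 * (k : ℝ) ^ 2 := by
  rw [plancherelMean_congr (g := fun l => (1 / 4) * fourthPowerSum l + (k : ℝ) ^ 2 / 2),
    plancherelMean_add, plancherelMean_const_mul, plancherelMean_fourthPowerSum hk.le,
    plancherelMean_const hk.le]
  · have : (0 : ℝ) ≤ k := Nat.cast_nonneg k
    nlinarith
  · intro l hl
    obtain ⟨j, hj⟩ := exists_eq_zero_of_mem_shiftedShapes hk hl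
    obtain ⟨hs, hl⟩ := mem_shiftedShapes.1 hl
    rw [(growthProb_moments hl hj hs).2]
    ring

end Transition

section Lindeberg

variable {N : ℕ}

lemma abs_pow_three_le {A : ℝ} (hA : 0 < A) (h : ℝ) : |h| ^ 3 ≤ (A * h ^ 2 + h ^ 4 / A) / 2 := by
  have h1 : h ^ 2 = |h| ^ 2 := (sq_abs h).symm
  have h2 : h ^ 4 = |h| ^ 4 := by rw [show h ^ 4 = (h ^ 2) ^ 2 by ring, h1]; ring
  rw [h1, h2]
  have h3 : A * (|h| ^ 4 / A) = |h| ^ 4 := mul_div_cancel₀ _ hA.ne'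
  have h4 : 0 ≤ |h| ^ 2 * (A - |h|) ^ 2 := by positivity
  nlinarith

lemma abs_sum_growthProb_Phi_sub_le {l : Fin N → ℕ} (hl : StrictAnti l) {j₀ : Fin N}
    (h0 : l j₀ = 0) {k : ℕ} (hk : ∑ i, l i = k + N.choose 2) {A : ℝ} (hA : 0 < A) (c u : ℝ) :
    |∑ i, growthProb l i * Phi (u - c * boxContent l i) - Phi (u / √(1 + c ^ 2 * k))| ≤
      (A * (c ^ 2 * k) + c ^ 4 / A * ∑ i, growthProb l i * boxContent l i ^ 4) / 2 +
        (c ^ 2 * k) ^ 2 / 2 := by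
  have hp := growthProb_nonneg hl
  have h1 := sum_growthProb_eq_one hl h0
  have h2 := sum_growthProb_mul_content hl h0
  have h3 := (growthProb_moments hl h0 hk).1
  have hheat := Phi_heat u (r := c ^ 2 * k) (by positivity)
  set E := fun i => Phi (u - c * boxContent l i) - Phi u + c * boxContent l i * stdDensity u +
    (c * boxContent l i) ^ 2 / 2 * (u * stdDensity u) with hE
  have h4 : ∑ i, growthProb l i * Phi (u - c * boxContent l i) =
      ∑ i, growthProb l i * E i + Phi u - c ^ 2 * k / 2 * (u * stdDensity u) := by
    have : ∑ i, growthProb l i * E i = ∑ i, growthProb l i * Phi (u - c * boxContent l i) -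
        (∑ i, growthProb l i) * Phi u +
        (∑ i, growthProb l i * boxContent l i) * (c * stdDensity u) +
        (∑ i, growthProb l i * boxContent l i ^ 2) * (c ^ 2 / 2 * (u * stdDensity u)) := by
      rw [Finset.sum_mul, Finset.sum_mul, Finset.sum_mul, ← Finset.sum_sub_distrib,
        ← Finset.sum_add_distrib, ← Finset.sum_add_distrib]
      exact Finset.sum_congr rfl fun i _ => by simp only [hE]; ring
    rw [this, h1, h2, h3]
    ring
  have h5 : |∑ i, growthProb l i * E i| ≤
      (A * (c ^ 2 * k) + c ^ 4 / A * ∑ i, growthProb l i * boxContent l i ^ 4) / 2 := by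
    calc |∑ i, growthProb l i * E i| ≤ ∑ i, |growthProb l i * E i| :=
          Finset.abs_sum_le_sum_abs _ _
      _ ≤ ∑ i, growthProb l i *
          ((A * (c * boxContent l i) ^ 2 + (c * boxContent l i) ^ 4 / A) / 2) := by
          apply Finset.sum_le_sum
          intro i _
          rw [abs_mul, abs_of_nonneg (hp i)]
          exact mul_le_mul_of_nonneg_left ((Phi_taylor _ _).trans (abs_pow_three_le hA _)) (hp i)
      _ = _ := by
          rw [← h3, Finset.mul_sum, Finset.mul_sum, Finset.mul_sum, ← Finset.sum_add_distrib,
            Finset.sum_div]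
          exact Finset.sum_congr rfl fun i _ => by ring
  rw [h4, abs_le]
  rw [abs_le] at h5 hheat
  constructor <;> linarith [h5.1, h5.2, hheat.1, hheat.2]

lemma abs_plancherelMean_le {k : ℕ} (f : (Fin N → ℕ) → ℝ) :
    |plancherelMean N k f| ≤ plancherelMean N k fun l => |f l| := by
  refine (Finset.abs_sum_le_sum_abs _ _).trans_eq (Finset.sum_congr rfl fun l _ => ?_)
  rw [abs_mul, abs_of_nonneg (plancherelWeight_nonneg k l)]

lemma abs_plancherelMean_step_le {k : ℕ} (hk : k < N) {A : ℝ} (hA : 0 < A) (s y : ℝ) {v : ℝ}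
    (hv : 0 < v) :
    |plancherelMean N (k + 1) (fun l => Phi ((y - s * contentSum l) / √v)) -
      plancherelMean N k (fun l => Phi ((y - s * contentSum l) / √(v + s ^ 2 * k)))| ≤
      (A * (s ^ 2 * k / v) + 2 * (s ^ 2 * k / v) ^ 2 / A) / 2 + (s ^ 2 * k / v) ^ 2 / 2 := by
  have hσ : 0 < √v := Real.sqrt_pos.2 hv
  have hsq : √v ^ 2 = v := Real.sq_sqrt hv.le
  set c := s / √v with hc
  have hc2 : c ^ 2 * k = s ^ 2 * k / v := by rw [hc, div_pow, hsq]; ring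
  have hroot : √(v + s ^ 2 * k) = √v * √(1 + c ^ 2 * k) := by
    rw [← Real.sqrt_mul hv.le, hc2]
    congr 1
    field_simp
  rw [plancherelMean_succ, ← hc2]
  have h1 := plancherelMean_add k (N := N) (fun l =>
    (∑ i, growthProb l i * Phi ((y - s * contentSum (addBox l i)) / √v)) -
      Phi ((y - s * contentSum l) / √(v + s ^ 2 * k)))
      (fun l => Phi ((y - s * contentSum l) / √(v + s ^ 2 * k)))
  simp only [sub_add_cancel] at h1
  rw [h1, add_sub_cancel_right]
  calc _ ≤ _ := abs_plancherelMean_le _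
    _ ≤ plancherelMean N k (fun l => (c ^ 4 / A / 2) *
          (∑ i, growthProb l i * boxContent l i ^ 4) +
          (A * (c ^ 2 * k) / 2 + (c ^ 2 * k) ^ 2 / 2)) := by
        apply plancherelMean_mono
        intro l hl
        obtain ⟨j, hj⟩ := exists_eq_zero_of_mem_shiftedShapes hk hl
        obtain ⟨hs, hl⟩ := mem_shiftedShapes.1 hl
        have h2 := abs_sum_growthProb_Phi_sub_le hl hj hs hA c ((y - s * contentSum l) / √v)
        have h3 : ∀ i, (y - s * contentSum (addBox l i)) / √v =
            (y - s * contentSum l) / √v - c * boxContent l i := by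
          intro i
          rw [contentSum_addBox, hc]
          ring
        simp only [h3, hroot, ← div_div]
        refine h2.trans_eq ?_
        ring
    _ ≤ _ := by
        rw [plancherelMean_add, plancherelMean_const_mul, plancherelMean_const hk.le]
        have h4 := mul_le_mul_of_nonneg_left (plancherelMean_fourth_moment_le hk)
          (show 0 ≤ c ^ 4 / A / 2 by positivity)
        have h5 : c ^ 4 / A / 2 * (2 * (k : ℝ) ^ 2) = 2 * (c ^ 2 * k) ^ 2 / A / 2 := by ring
        linarith

lemma sub_div_cube_le {a b : ℝ} (hb : 0 < b) (hab : b ≤ a) (h2 : a ^ 2 ≤ 2 * b ^ 2) :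
    (a ^ 2 - b ^ 2) / b ^ 3 ≤ 4 * (1 / b - 1 / a) := by
  have ha : 0 < a := hb.trans_le hab
  have h3 : a ≤ 3 / 2 * b := by nlinarith
  have h4 : a * (a + b) ≤ 4 * b ^ 2 := by nlinarith
  rw [div_le_iff₀ (by positivity)]
  have h5 : 4 * (1 / b - 1 / a) * b ^ 3 = (a - b) * (4 * b ^ 2) / a := by
    field_simp
  rw [h5, le_div_iff₀ ha]
  nlinarith [mul_le_mul_of_nonneg_left h4 (sub_nonneg.2 hab)]

/-- A single replacement step with the error in telescoping form. -/
lemma abs_plancherelMean_step_le_sub {k : ℕ} (hk : k < N) {s ε y v : ℝ} (hε : 0 ≤ ε)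
    (hsε : s ^ 2 * k ≤ ε ^ 2) (hv : ε ^ 2 ≤ v) (hv0 : 0 < v) :
    |plancherelMean N (k + 1) (fun l => Phi ((y - s * contentSum l) / √v)) -
      plancherelMean N k (fun l => Phi ((y - s * contentSum l) / √(v + s ^ 2 * k)))| ≤
      8 * ε * (1 / √v - 1 / √(v + s ^ 2 * k)) := by
  have hσ : 0 < √v := Real.sqrt_pos.2 hv0
  have hsq : √v ^ 2 = v := Real.sq_sqrt hv0.le
  have ht : 0 ≤ s ^ 2 * k := by positivity
  have hsq' : √(v + s ^ 2 * k) ^ 2 = v + s ^ 2 * k := Real.sq_sqrt (by positivity)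
  set t := s ^ 2 * (k : ℝ) with htdef
  rcases ht.eq_or_lt with h0 | hpos
  · have h1 := abs_plancherelMean_step_le hk one_pos s y hv0
    rw [← htdef, ← h0] at h1
    rw [← h0]
    simpa using h1
  · have hr : 0 < t / v := by positivity
    have hρ : 0 < √t / √v := by positivity
    have hr1 : t / v ≤ 1 := (div_le_one hv0).2 (hsε.trans hv)
    have hρr : (√t / √v) ^ 2 = t / v := by rw [div_pow, Real.sq_sqrt ht, hsq]
    have h1 := abs_plancherelMean_step_le hk hρ s y hv0
    have h2 := sub_div_cube_le hσ (Real.sqrt_le_sqrt (show v ≤ v + t by linarith)) (by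
      rw [hsq, hsq']; linarith)
    have hρε : √t / √v ≤ ε / √v :=
      div_le_div_of_nonneg_right (Real.sqrt_le_iff.2 ⟨hε, hsε⟩) hσ.le
    rw [hsq, hsq', add_sub_cancel_left] at h2
    rw [← htdef] at h1
    refine h1.trans ?_
    have h3 : (√t / √v * (t / v) + 2 * (t / v) ^ 2 / (√t / √v)) / 2 + (t / v) ^ 2 / 2 ≤
        2 * ((t / v) * (√t / √v)) := by
      set ρ := √t / √v
      rw [← hρr] at hr1 ⊢
      have h4 : 2 * (ρ ^ 2) ^ 2 / ρ = 2 * ρ ^ 3 := by field_simp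
      rw [h4]
      have h5 : ρ ≤ 1 := by nlinarith
      have h6 : 0 ≤ ρ ^ 3 * (1 - ρ) := mul_nonneg (by positivity) (by linarith)
      nlinarith
    refine h3.trans ?_
    have h4 : (t / v) * (ε / √v) = ε * (t / √v ^ 3) := by
      rw [show √v ^ 3 = √v ^ 2 * √v by ring, hsq]
      field_simp
    calc 2 * ((t / v) * (√t / √v)) ≤ 2 * ((t / v) * (ε / √v)) := by gcongr
      _ = 2 * ε * (t / √v ^ 3) := by rw [h4]; ring
      _ ≤ 2 * ε * (4 * (1 / √v - 1 / √(v + t))) := by gcongr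
      _ = _ := by ring

lemma abs_mul_stdDensity_le_one (u : ℝ) : |u * stdDensity u| ≤ 1 := by
  apply abs_mul_stdDensity_le one_pos
  rw [abs_le]
  constructor <;> nlinarith [sq_nonneg (u - 1), sq_nonneg (u + 1), sq_nonneg (u ^ 2)]

lemma abs_Phi_div_sqrt_sub_le {r : ℝ} (hr : 0 ≤ r) (hr1 : r ≤ 1) (u : ℝ) :
    |Phi (u / √(1 + r)) - Phi u| ≤ r := by
  have h1 := abs_le.1 (Phi_heat u hr)
  have h2 := abs_le.1 (abs_mul_stdDensity_le_one u)
  rw [abs_le]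
  constructor <;> nlinarith [h1.1, h1.2, mul_le_mul_of_nonneg_left h2.1 hr,
    mul_le_mul_of_nonneg_left h2.2 hr]

/-- Gaussian smoothing at scale `δ = m ^ (-1/4)` of the content sum under Plancherel measure. -/
lemma abs_plancherelMean_smoothed_sub_Phi_le {m : ℕ} (hm : 4 ≤ m) {δ : ℝ} (hδ : 0 < δ)
    (hδm : δ ^ 4 * m = 1) (y : ℝ) :
    |plancherelMean (m + 1) m (fun l => Phi ((y - √2 / m * contentSum l) / δ)) - Phi y| ≤
      13 * δ := by
  have hm4 : (4 : ℝ) ≤ m := by exact_mod_cast hm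
  have hm0 : (m : ℝ) ≠ 0 := by positivity
  have hδ4 : δ ^ 4 = 1 / m := by field_simp; linarith
  have hδ2 : δ ^ 2 ≤ 1 / 2 := by
    have : (δ ^ 2) ^ 2 ≤ (1 / 2) ^ 2 := by
      rw [← pow_mul, hδ4, div_le_iff₀ (by positivity)]
      linarith
    exact le_of_sq_le_sq this (by norm_num)
  have hδ1 : δ ≤ 1 := by nlinarith
  set s := √2 / (m : ℝ) with hs
  have hs2 : s ^ 2 = 2 / m ^ 2 := by rw [hs, div_pow, Real.sq_sqrt (by norm_num)]
  set ε := √2 * δ ^ 2 with hε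
  have hε2 : ε ^ 2 = 2 * δ ^ 4 := by rw [hε, mul_pow, Real.sq_sqrt (by norm_num)]; ring
  set v : ℕ → ℝ := fun k => δ ^ 2 + (m * (m - 1) - k * (k - 1)) / m ^ 2 with hv
  have hvs : ∀ k, v k = v (k + 1) + s ^ 2 * k := by
    intro k
    simp only [hv, hs2]
    push_cast
    field_simp
    ring
  have hvδ : ∀ k : ℕ, k ≤ m → δ ^ 2 ≤ v k := by
    intro k hk
    have hk' : (k : ℝ) ≤ m := by exact_mod_cast hk
    have : (k : ℝ) * (k - 1) ≤ m * (m - 1) := by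
      have : (0 : ℝ) ≤ k := Nat.cast_nonneg k
      nlinarith
    have : 0 ≤ (m * (m - 1) - k * (k - 1)) / (m : ℝ) ^ 2 :=
      div_nonneg (by linarith) (by positivity)
    simp only [hv]
    linarith
  have hind : ∀ k ≤ m,
      |plancherelMean (m + 1) k (fun l => Phi ((y - s * contentSum l) / √(v k))) -
        plancherelMean (m + 1) 0 (fun l => Phi ((y - s * contentSum l) / √(v 0)))| ≤
        8 * ε * (1 / √(v k) - 1 / √(v 0)) := by
    intro k hk
    induction k with
    | zero => simp
    | succ k ih =>
      have hk' : ((k : ℝ) + 1) ≤ m := by exact_mod_cast hk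
      have h1 := ih (by omega)
      have h2 := abs_plancherelMean_step_le_sub (N := m + 1) (k := k) (by omega) (s := s) (ε := ε)
        (y := y) (v := v (k + 1)) (by positivity)
        (by
          rw [hε2, hδ4, hs2]
          field_simp
          linarith)
        (by
          rw [hε2]
          have := hvδ (k + 1) hk
          nlinarith [sq_nonneg δ])
        (lt_of_lt_of_le (by positivity) (hvδ (k + 1) hk))
      rw [← hvs k] at h2
      refine (abs_sub_le _ _ _).trans ((add_le_add h2 h1).trans_eq ?_)
      ring
  have h1 := hind m le_rfl
  have hvm : √(v m) = δ := by
    simp only [hv, sub_self, zero_div, add_zero]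
    exact Real.sqrt_sq hδ.le
  have hv0 : v 0 = 1 + (δ ^ 2 - δ ^ 4) := by
    simp only [hv, hδ4]
    push_cast
    field_simp
    ring
  rw [plancherelMean_zero, contentSum_emptyShape, mul_zero, sub_zero, hvm] at h1
  have h2 := abs_Phi_div_sqrt_sub_le (r := δ ^ 2 - δ ^ 4) (by nlinarith [sq_nonneg δ])
    (by nlinarith [sq_nonneg (δ ^ 2)]) y
  rw [← hv0] at h2
  refine (abs_sub_le _ _ _).trans ((add_le_add h1 h2).trans ?_)
  have h3 : 0 ≤ 1 / √(v 0) := by positivity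
  have hsqrt2 : √2 ≤ 1.5 := by
    rw [Real.sqrt_le_left (by norm_num)]
    norm_num
  have h4 : 8 * ε * (1 / δ) = 8 * √2 * δ := by
    rw [hε]
    field_simp
  have h5 : 8 * ε * (1 / δ - 1 / √(v 0)) ≤ 8 * √2 * δ := by
    rw [← h4]
    exact mul_le_mul_of_nonneg_left (by linarith) (by positivity)
  nlinarith [sq_nonneg (δ ^ 2)]

end Lindeberg

section Partition

lemma mem_iff_lt_card_of_isLowerSet {S : Finset ℕ} (hS : IsLowerSet (S : Set ℕ)) (j : ℕ) :
    j ∈ S ↔ j < #S := by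
  constructor
  · intro h
    have := Finset.card_le_card (s := Finset.Iic j) (t := S)
      fun a ha => hS (Finset.mem_Iic.1 ha) h
    rw [Nat.card_Iic] at this
    omega
  · intro h
    by_contra hj
    have := Finset.card_le_card (s := S) (t := Finset.Iio j) fun a ha => by
      rw [Finset.mem_Iio]
      by_contra hja
      exact hj (hS (not_lt.1 hja) ha)
    rw [Nat.card_Iio] at this
    omega

lemma mem_iff_lt_card_of_isLowerSet_fin {N : ℕ} {S : Finset (Fin N)}
    (hS : IsLowerSet (S : Set (Fin N))) (j : Fin N) : j ∈ S ↔ (j : ℕ) < #S := by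
  constructor
  · intro h
    have := Finset.card_le_card (s := Finset.Iic j) (t := S)
      fun a ha => hS (Finset.mem_Iic.1 ha) h
    rw [Fin.card_Iic] at this
    omega
  · intro h
    by_contra hj
    have := Finset.card_le_card (s := S) (t := Finset.Iio j) fun a ha => by
      rw [Finset.mem_Iio]
      by_contra hja
      exact hj (hS (not_lt.1 hja) ha)
    rw [Fin.card_Iio] at this
    omega

variable {n : ℕ}

lemma colLen_antitone (lam : n.Partition) : Antitone (colLen lam) := fun _ _ h =>
  Multiset.card_le_card (Multiset.monotone_filter_right _ fun _ hp => h.trans_lt hp)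

lemma colLen_eq_zero (lam : n.Partition) {j : ℕ} (hj : n ≤ j) : colLen lam j = 0 := by
  rw [colLen, Multiset.card_eq_zero, Multiset.filter_eq_nil]
  intro p hp
  have := Nat.Partition.le_of_mem_parts hp
  omega

lemma colLen_le (lam : n.Partition) (j : ℕ) : colLen lam j ≤ n := by
  refine (Multiset.card_le_card (Multiset.filter_le _ _)).trans ?_
  have := Multiset.card_nsmul_le_sum (s := lam.parts) (a := 1) fun p hp => lam.parts_pos hp
  rwa [lam.parts_sum, smul_eq_mul, mul_one] at this

lemma lt_rowLen_iff (lam : n.Partition) {i j : ℕ} : j < rowLen lam i ↔ i < colLen lam j := by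
  rw [rowLen, ← mem_iff_lt_card_of_isLowerSet, Finset.mem_filter, Finset.mem_range]
  · refine and_iff_right_of_imp fun h => ?_
    by_contra hj
    rw [colLen_eq_zero lam (not_lt.1 hj)] at h
    omega
  · intro a b hab ha
    simp only [Finset.coe_filter, Finset.mem_range, Set.mem_ofPred_eq] at ha ⊢
    exact ⟨hab.trans_lt ha.1, ha.2.trans_le (colLen_antitone lam hab)⟩

lemma rowLen_le (lam : n.Partition) (i : ℕ) : rowLen lam i ≤ n := by
  by_contra! h
  rw [lt_rowLen_iff, colLen_eq_zero lam le_rfl] at h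
  omega

lemma rowLen_antitone (lam : n.Partition) : Antitone (rowLen lam) := by
  intro i i' h
  by_contra! h'
  have h1 := (lt_rowLen_iff lam).1 h'
  exact lt_irrefl _ ((lt_rowLen_iff lam).2 (h.trans_lt h1))

lemma rowLen_eq_zero (lam : n.Partition) {i : ℕ} (hi : n ≤ i) : rowLen lam i = 0 := by
  by_contra h
  have h1 := (lt_rowLen_iff lam).1 (Nat.pos_of_ne_zero h)
  have := colLen_le lam 0
  omega

lemma sum_card_filter_lt {n : ℕ} (s : Multiset ℕ) (hs : ∀ p ∈ s, p ≤ n) :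
    ∑ j ∈ range n, (s.filter fun p => j < p).card = s.sum := by
  induction s using Multiset.induction_on with
  | empty => simp
  | cons a s ih =>
    rw [Multiset.sum_cons, ← ih fun p hp => hs p (Multiset.mem_cons_of_mem hp)]
    have ha := hs a (Multiset.mem_cons_self a s)
    simp only [Multiset.filter_cons, Multiset.card_add, Finset.sum_add_distrib]
    congr 1
    have : ∀ j, (if j < a then ({a} : Multiset ℕ) else 0).card = if j < a then 1 else 0 := by
      intro j
      split_ifs <;> rfl
    simp only [this]
    rw [← Finset.card_filter]
    have : (range n).filter (· < a) = range a := by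
      ext j
      simp only [Finset.mem_filter, Finset.mem_range]
      omega
    rw [this, Finset.card_range]

lemma sum_colLen (lam : n.Partition) : ∑ j ∈ range n, colLen lam j = n := by
  conv_rhs => rw [← lam.parts_sum]
  exact sum_card_filter_lt _ fun p hp => Nat.Partition.le_of_mem_parts hp

lemma filter_lt_rowLen (lam : n.Partition) (i : ℕ) :
    (range n).filter (· < rowLen lam i) = range (rowLen lam i) := by
  ext j
  have := rowLen_le lam i
  simp only [Finset.mem_filter, Finset.mem_range]
  omega

lemma sum_mul_colLen (lam : n.Partition) (f : ℕ → ℝ) :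
    ∑ j ∈ range n, f j * colLen lam j = ∑ i ∈ range n, ∑ j ∈ range (rowLen lam i), f j := by
  simp only [← filter_lt_rowLen, Finset.sum_filter]
  rw [Finset.sum_comm]
  apply Finset.sum_congr rfl
  intro j _
  simp only [lt_rowLen_iff]
  rw [← Finset.sum_filter]
  have : (range n).filter (· < colLen lam j) = range (colLen lam j) := by
    ext i
    have := colLen_le lam j
    simp only [Finset.mem_filter, Finset.mem_range]
    omega
  rw [this]
  simp [mul_comm]

lemma sum_rowLen (lam : n.Partition) : ∑ i ∈ range n, rowLen lam i = n := by
  have h := sum_mul_colLen lam fun _ => 1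
  simp only [one_mul, Finset.sum_const, Finset.card_range, nsmul_eq_mul, mul_one] at h
  exact Eq.trans (by exact_mod_cast h.symm) (sum_colLen lam)

/-- The strictly decreasing tuple `λ i + n - i` of a partition of `n`. -/
def shiftedShape (lam : n.Partition) : Fin (n + 1) → ℕ := fun i => rowLen lam i + (n - i)

lemma sum_fin_rowLen {R : Type*} [AddCommMonoid R] (lam : n.Partition) (f : ℕ → ℕ → R)
    (hf : f n 0 = 0) :
    ∑ i : Fin (n + 1), f i (rowLen lam i) = ∑ i ∈ range n, f i (rowLen lam i) := by
  rw [Fin.sum_univ_eq_sum_range fun i => f i (rowLen lam i), Finset.sum_range_succ,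
    rowLen_eq_zero lam le_rfl, hf, add_zero]

lemma strictAnti_shiftedShape (lam : n.Partition) : StrictAnti (shiftedShape lam) := by
  intro i j h
  have h1 := rowLen_antitone lam (Fin.lt_def.1 h).le
  have h2 := Fin.lt_def.1 h
  have := j.isLt
  simp only [shiftedShape]
  omega

lemma shiftedShape_mem (lam : n.Partition) : shiftedShape lam ∈ shiftedShapes (n + 1) n := by
  refine mem_shiftedShapes.2 ⟨?_, strictAnti_shiftedShape lam⟩
  simp only [shiftedShape, Finset.sum_add_distrib]
  rw [sum_fin_rowLen lam (fun _ r => r) rfl, sum_rowLen, ← sum_sub_eq_choose_two]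
  rfl

lemma parts_eq_of_colLen_eq {lam mu : n.Partition} (h : ∀ j, colLen lam j = colLen mu j) :
    lam = mu := by
  have hcount : ∀ (nu : n.Partition) (p : ℕ),
      colLen nu p = nu.parts.count (p + 1) + colLen nu (p + 1) := by
    intro nu p
    rw [colLen, colLen, Multiset.count_eq_card_filter_eq, ← Multiset.card_add,
      Multiset.filter_add_filter]
    have h1 : nu.parts.filter (fun q => p + 1 = q ∧ p + 1 < q) = 0 :=
      Multiset.filter_eq_nil.2 fun q _ => by omega
    rw [h1, add_zero]
    congr 1
    apply Multiset.filter_congr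
    intro q _
    omega
  apply Nat.Partition.ext
  rw [Multiset.ext]
  intro p
  cases p with
  | zero =>
    have h0 : ∀ nu : n.Partition, nu.parts.count 0 = 0 := fun nu =>
      Multiset.count_eq_zero.2 fun h => (nu.parts_pos h).ne' rfl
    rw [h0, h0]
  | succ p =>
    have h1 := hcount lam p
    have h2 := hcount mu p
    rw [h p, h (p + 1)] at h1
    omega

lemma shiftedShape_injective : Function.Injective (shiftedShape (n := n)) := by
  intro lam mu h
  have hrow : ∀ i, rowLen lam i = rowLen mu i := by
    intro i
    by_cases hi : i < n + 1
    · have := congrFun h ⟨i, hi⟩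
      simpa [shiftedShape] using this
    · rw [rowLen_eq_zero lam (by omega), rowLen_eq_zero mu (by omega)]
  apply parts_eq_of_colLen_eq
  intro j
  apply le_antisymm
  · by_contra! h1
    rw [← lt_rowLen_iff, hrow, lt_rowLen_iff] at h1
    exact lt_irrefl _ h1
  · by_contra! h1
    rw [← lt_rowLen_iff, ← hrow, lt_rowLen_iff] at h1
    exact lt_irrefl _ h1

lemma exists_shiftedShape_eq {l : Fin (n + 1) → ℕ} (hl : l ∈ shiftedShapes (n + 1) n) :
    ∃ lam : n.Partition, shiftedShape lam = l := by
  obtain ⟨hsum, hl⟩ := mem_shiftedShapes.1 hl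
  set r : Fin (n + 1) → ℕ := fun i => l i - (n - i) with hr
  have hle : ∀ i : Fin (n + 1), n - (i : ℕ) ≤ l i := fun i => sub_le_of_strictAnti hl i
  have hanti : Antitone r := by
    intro i j hij
    have h1 := add_sub_le_of_strictAnti hl hij
    have h2 := hle j
    have h3 := Fin.le_def.1 hij
    have := j.isLt
    simp only [hr]
    omega
  have hrsum : (univ.val.map r).sum = n := by
    change ∑ i, r i = n
    have h1 : ∑ i, (r i + (n - (i : ℕ))) = ∑ i, l i :=
      Finset.sum_congr rfl fun i _ => Nat.sub_add_cancel (hle i)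
    have h2 : ∑ i : Fin (n + 1), (n - (i : ℕ)) = (n + 1).choose 2 := sum_sub_eq_choose_two
    rw [Finset.sum_add_distrib, h2, hsum] at h1
    omega
  refine ⟨Nat.Partition.ofSums n (univ.val.map r) hrsum, ?_⟩
  set lam := Nat.Partition.ofSums n (univ.val.map r) hrsum with hlam
  have hcol : ∀ j, colLen lam j = #(univ.filter fun i => j < r i) := by
    intro j
    have hparts : lam.parts = (univ.val.map r).filter (· ≠ 0) := rfl
    rw [colLen, hparts, Multiset.filter_filter, Multiset.filter_map, Multiset.card_map,
      Finset.card_def, Finset.filter_val]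
    congr 1
    apply Multiset.filter_congr
    intro i _
    simp only [Function.comp_apply]
    omega
  have hrow : ∀ i : Fin (n + 1), rowLen lam i = r i := by
    intro i
    have h1 : ∀ j, j < rowLen lam i ↔ j < r i := by
      intro j
      rw [lt_rowLen_iff, hcol, ← mem_iff_lt_card_of_isLowerSet_fin]
      · simp
      · intro a b hab ha
        simp only [Finset.coe_filter, Finset.mem_univ, true_and, Set.mem_ofPred_eq] at ha ⊢
        exact ha.trans_le (hanti hab)
    exact eq_of_forall_lt_iff h1
  ext i
  rw [shiftedShape, hrow]
  exact Nat.sub_add_cancel (hle i)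

lemma sum_shiftedShape (f : (Fin (n + 1) → ℕ) → ℝ) :
    ∑ lam : n.Partition, f (shiftedShape lam) = ∑ l ∈ shiftedShapes (n + 1) n, f l :=
  Finset.sum_bij (fun lam _ => shiftedShape lam) (fun lam _ => shiftedShape_mem lam)
    (fun _ _ _ _ h => shiftedShape_injective h)
    (fun _ hl => (exists_shiftedShape_eq hl).imp fun _ h => ⟨mem_univ _, h⟩) fun _ _ => rfl

lemma boxContent_shiftedShape (lam : n.Partition) (i : Fin (n + 1)) :
    boxContent (shiftedShape lam) i = rowLen lam i - i := by
  have := i.isLt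
  simp only [boxContent, shiftedShape]
  push_cast [Nat.cast_sub (show (i : ℕ) ≤ n by omega)]
  ring

lemma contentSum_shiftedShape (lam : n.Partition) :
    contentSum (shiftedShape lam) = nStatConj lam - nStat lam := by
  have h1 : (nStatConj lam : ℝ) = ∑ i ∈ range n, (rowLen lam i : ℝ) * (rowLen lam i - 1) / 2 := by
    rw [nStatConj]
    push_cast
    rw [sum_mul_colLen lam fun j => (j : ℝ)]
    apply Finset.sum_congr rfl
    intro i _
    rw [← Nat.cast_sum, Finset.sum_range_id, ← Nat.choose_two_right, Nat.cast_choose_two]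
  have h2 : (nStat lam : ℝ) = ∑ i ∈ range n, (i : ℝ) * rowLen lam i := by
    rw [nStat]
    push_cast
    rfl
  rw [contentSum, h1, h2, ← Finset.sum_sub_distrib]
  simp only [boxContent_shiftedShape]
  rw [sum_fin_rowLen lam (fun i r => (((r : ℝ) - i) * (r - i - 1) - i * (i + 1)) / 2)
    (by push_cast; ring)]
  exact Finset.sum_congr rfl fun i _ => by ring

/-- The hook length of the cell in row `i` and column `j`. -/
def hookLen (lam : n.Partition) (i j : ℕ) : ℕ := arm lam (i, j) + leg lam (i, j) + 1

lemma prod_hookLen_mul_prod_sub (lam : n.Partition) (i : Fin (n + 1)) :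
    (∏ j ∈ range (rowLen lam i), hookLen lam i j) *
      ∏ k ∈ Ioi i, (shiftedShape lam i - shiftedShape lam k) = (shiftedShape lam i).factorial := by
  have hi := i.isLt
  have hanti := strictAnti_shiftedShape lam
  have hprod := prod_eq_factorial_of_injOn (M := shiftedShape lam i)
    (s := (range (rowLen lam i)).disjSum (Ioi i))
    (f := Sum.elim (hookLen lam i) fun k => shiftedShape lam i - shiftedShape lam k)
  rw [Finset.prod_disjSum] at hprod
  refine hprod ?_ ?_ ?_
  · have hcross : ∀ j k, j < rowLen lam i → i < k →
        hookLen lam i j ≠ shiftedShape lam i - shiftedShape lam k := by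
      intro j k hj hk heq
      have h1 := (lt_rowLen_iff lam).1 hj
      have h2 := hanti hk
      have h3 := k.isLt
      have h4 := lt_rowLen_iff lam (i := k) (j := j)
      simp only [shiftedShape, hookLen, arm, leg] at heq h2
      omega
    rintro (j | k) h (j' | k') h' heq
    · have hj : j < rowLen lam i := by simpa using h
      have hj' : j' < rowLen lam i := by simpa using h'
      have h1 := (lt_rowLen_iff lam).1 hj
      have h2 := (lt_rowLen_iff lam).1 hj'
      have h3 := fun h => colLen_antitone lam (a := j) (b := j') h
      have h4 := fun h => colLen_antitone lam (a := j') (b := j) h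
      simp only [Sum.elim_inl, hookLen, arm, leg] at heq
      rcases lt_trichotomy j j' with h5 | h5 | h5
      · have := h3 h5.le
        omega
      · rw [h5]
      · have := h4 h5.le
        omega
    · exact absurd heq (hcross j k' (by simpa using h) (by simpa using h'))
    · exact absurd heq.symm (hcross j' k (by simpa using h') (by simpa using h))
    · have hk : i < k := by simpa using h
      have hk' : i < k' := by simpa using h'
      have h1 := hanti hk
      have h2 := hanti hk'
      simp only [Sum.elim_inr] at heq
      rw [hanti.injective (show shiftedShape lam k = shiftedShape lam k' by omega)]
  · rw [Finset.card_disjSum, Finset.card_range, Fin.card_Ioi]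
    simp [shiftedShape]
  · rintro (j | k) h
    · have hj : j < rowLen lam i := by simpa using h
      have h1 := (lt_rowLen_iff lam).1 hj
      have h2 := colLen_le lam j
      simp only [Sum.elim_inl, hookLen, arm, leg, shiftedShape]
      omega
    · have hk : i < k := by simpa using h
      have h1 := hanti hk
      simp only [Sum.elim_inr]
      omega

lemma prod_cells_hookLen (lam : n.Partition) :
    ∏ s ∈ cells lam, hookLen lam s.1 s.2 =
      ∏ i : Fin (n + 1), ∏ j ∈ range (rowLen lam i), hookLen lam i j := by
  rw [Fin.prod_univ_eq_prod_range fun i => ∏ j ∈ range (rowLen lam i), hookLen lam i j,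
    Finset.prod_range_succ, rowLen_eq_zero lam le_rfl, Finset.prod_range_zero, mul_one, cells,
    Finset.prod_filter, Finset.prod_product]
  apply Finset.prod_congr rfl
  intro i _
  rw [← filter_lt_rowLen, Finset.prod_filter]

/-- The hook length formula in product form. -/
lemma prod_cells_hookLen_mul_diffProd (lam : n.Partition) :
    ((∏ s ∈ cells lam, hookLen lam s.1 s.2 : ℕ) : ℝ) * diffProd (castTuple (shiftedShape lam)) =
      ∏ i, ((shiftedShape lam i).factorial : ℝ) := by
  have h : diffProd (castTuple (shiftedShape lam)) =
      ((∏ i, ∏ k ∈ Ioi i, (shiftedShape lam i - shiftedShape lam k) : ℕ) : ℝ) := by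
    rw [diffProd]
    push_cast
    apply Finset.prod_congr rfl
    intro i _
    rw [Finset.filter_lt_eq_Ioi]
    apply Finset.prod_congr rfl
    intro k hk
    rw [Nat.cast_sub (strictAnti_shiftedShape lam (Finset.mem_Ioi.1 hk)).le]
    rfl
  rw [h, prod_cells_hookLen, ← Nat.cast_mul, ← Finset.prod_mul_distrib,
    Finset.prod_congr rfl fun i _ => prod_hookLen_mul_prod_sub lam i]
  push_cast
  rfl

lemma jackP_one_eq (lam : n.Partition) : jackP 1 lam = plancherelWeight n (shiftedShape lam) := by
  have h1 : cLow 1 lam = ((∏ s ∈ cells lam, hookLen lam s.1 s.2 : ℕ) : ℝ) := by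
    rw [cLow]
    push_cast [hookLen]
    simp
  have h2 : cUp 1 lam = ((∏ s ∈ cells lam, hookLen lam s.1 s.2 : ℕ) : ℝ) := by
    rw [← h1]
    rfl
  have h3 := prod_cells_hookLen_mul_diffProd lam
  have h4 := diffProd_pos (strictAnti_shiftedShape lam)
  rw [jackP, h1, h2, plancherelWeight, ← h3, div_mul_cancel_right₀ h4.ne']
  simp only [one_pow, one_mul]
  rw [inv_pow, div_eq_mul_inv, sq]

lemma sum_jackP_mul (f : (Fin (n + 1) → ℕ) → ℝ) :
    ∑ lam : n.Partition, jackP 1 lam * f (shiftedShape lam) = plancherelMean (n + 1) n f := by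
  simp only [jackP_one_eq]
  exact sum_shiftedShape fun l => plancherelWeight n l * f l

end Partition

section CentralLimit

variable {n : ℕ}

lemma sum_jackP_one : ∑ lam : n.Partition, jackP 1 lam = 1 := by
  simpa [plancherelMean_one n.le_succ] using sum_jackP_mul (n := n) fun _ => 1

lemma jackP_one_nonneg (lam : n.Partition) : 0 ≤ jackP 1 lam := by
  rw [jackP_one_eq]
  exact plancherelWeight_nonneg _ _

lemma rpow_neg_quarter_pow_four_mul (hn : 0 < n) : ((n : ℝ) ^ (-(1 / 4 : ℝ))) ^ 4 * n = 1 := by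
  have hn' : (0 : ℝ) < n := by exact_mod_cast hn
  rw [← Real.rpow_natCast, ← Real.rpow_mul hn'.le, show -(1 / 4 : ℝ) * (4 : ℕ) = -1 by norm_num,
    Real.rpow_neg_one, inv_mul_cancel₀ hn'.ne']

end CentralLimit

/-- Central limit theorem for Plancherel measure (Theorem 1 of the paper). -/
theorem plancherel_clt (n : ℕ) (hn : 2 ≤ n) (x₀ : ℝ) :
    |(∑ lam : n.Partition,
        if Real.sqrt 2 / n * ((nStatConj lam : ℝ) - nStat lam) ≤ x₀ then jackP 1 lam else 0) -
      Phi x₀| ≤ 40.1 * (n : ℝ) ^ (-(1 / 4 : ℝ)) := by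
  have hn0 : (0 : ℝ) < n := by positivity
  set δ : ℝ := (n : ℝ) ^ (-(1 / 4 : ℝ)) with hδ
  have hδ0 : 0 < δ := Real.rpow_pos_of_pos hn0 _
  have hδn : δ ^ 4 * n = 1 := rpow_neg_quarter_pow_four_mul (by omega)
  change |weightedCdf (fun lam : n.Partition => jackP 1 lam)
    (fun lam => √2 / n * ((nStatConj lam : ℝ) - nStat lam)) x₀ - Phi x₀| ≤ _
  rcases lt_or_ge n 4 with h4 | h4
  · have h5 : (n : ℝ) ≤ 4 := by exact_mod_cast h4.le
    have h6 : 1 / 2 ≤ δ := by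
      by_contra! h
      have : δ ^ 4 < (1 / 2) ^ 4 := pow_lt_pow_left₀ h hδ0.le (by norm_num)
      nlinarith
    have h7 := weightedCdf_nonneg (W := fun lam => √2 / n * ((nStatConj lam : ℝ) - nStat lam))
      (jackP_one_nonneg (n := n)) x₀
    have h8 := weightedCdf_le_one (W := fun lam => √2 / n * ((nStatConj lam : ℝ) - nStat lam))
      (jackP_one_nonneg (n := n)) sum_jackP_one x₀
    have h9 := Phi_nonneg x₀
    have h10 := Phi_le_one x₀
    rw [abs_le]
    constructor <;> linarith
  · refine (abs_weightedCdf_sub_Phi_le (δ := δ) (η := 13 * δ) jackP_one_nonneg sum_jackP_one hδ0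
      (fun y => ?_) x₀).trans (by linarith)
    have h := abs_plancherelMean_smoothed_sub_Phi_le h4 hδ0 hδn y
    rw [← sum_jackP_mul] at h
    simpa only [contentSum_shiftedShape] using h

end JackTest
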